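/- Let D and D' be division rings with |D| ≥ 4, and let m, n, m', n' ≥ 2 be integers with m' ≥ n and n' ≥ m. Suppose θ: D^{m×n} → D'^{m'×n'} is a non-degenerate graph homomorphism with θ(0) = 0 such that θ(M_i) ⊆ N'_i for i = 1, …, m and θ(N_j) ⊆ M'_j for j = 1, …, n. Then there exist invertible diagonal matrices P ∈ GL_{n'}(D') and Q ∈ GL_{m'}(D'), a nonzero ring anti-homomorphism σ: D → D', and a matrix L ∈ D'^{m×n} such that I_m + L·ᵗ(X^σ) is invertible for every X ∈ D^{m×n} and θ(X) = P · diag(ᵗ(X^σ)·(I_m + L·ᵗ(X^σ))^{-1}, 0) · Q for all X ∈ D^{m×n}. In particular, if σ is surjective then L = 0 and σ is a ring anti-isomorphism. Here X^σ denotes applying σ entrywise and ᵗ denotes the transpose. -/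

import Mathlib

open Matrix

/-- Rank of a matrix over a division ring: dimension of the left row space. -/
noncomputable def mrank {D : Type} [DivisionRing D] {m n : ℕ} (A : Matrix (Fin m) (Fin n) D) : ℕ :=
  Module.finrank D (Submodule.span D (Set.range fun i : Fin m => fun j : Fin n => A i j))

/-- The standard maximal set of type one: matrices whose rows other than the first are zero. -/
def M1set (D : Type) [DivisionRing D] (m n : ℕ) : Set (Matrix (Fin m) (Fin n) D) :=
  {X | ∀ i j, i.val ≠ 0 → X i j = 0}

/-- The standard maximal set of type two: matrices whose columns other than the first are zero. -/
def N1set (D : Type) [DivisionRing D] (m n : ℕ) : Set (Matrix (Fin m) (Fin n) D) :=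
  {X | ∀ i j, j.val ≠ 0 → X i j = 0}

/-- A maximal set of type one: a set of the form `P·M₁ + A` with `P` invertible. -/
def IsTypeOne {D : Type} [DivisionRing D] {m n : ℕ} (S : Set (Matrix (Fin m) (Fin n) D)) : Prop :=
  ∃ P : Matrix (Fin m) (Fin m) D, ∃ A : Matrix (Fin m) (Fin n) D,
    IsUnit P ∧ S = (fun X => P * X + A) '' M1set D m n

/-- A maximal set of type two: a set of the form `N₁·Q + A` with `Q` invertible. -/
def IsTypeTwo {D : Type} [DivisionRing D] {m n : ℕ} (S : Set (Matrix (Fin m) (Fin n) D)) : Prop :=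
  ∃ Q : Matrix (Fin n) (Fin n) D, ∃ A : Matrix (Fin m) (Fin n) D,
    IsUnit Q ∧ S = (fun X => X * Q + A) '' N1set D m n

/-- A maximal set (maximal clique of the adjacency graph): of type one or type two. -/
def IsMaximalSet {D : Type} [DivisionRing D] {m n : ℕ}
    (S : Set (Matrix (Fin m) (Fin n) D)) : Prop :=
  IsTypeOne S ∨ IsTypeTwo S

/-- A graph homomorphism `φ` is degenerate if there is a matrix `A` of rank at most one and two
maximal sets of different types `Ms`, `Ns` in the target with `φ A ∈ Ms ∩ Ns` and the image of
the unit ball around `A` contained in `Ms ∪ Ns`. -/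
def Degenerate {D D' : Type} [DivisionRing D] [DivisionRing D'] {m n m' n' : ℕ}
    (φ : Matrix (Fin m) (Fin n) D → Matrix (Fin m') (Fin n') D') : Prop :=
  ∃ A : Matrix (Fin m) (Fin n) D, mrank A ≤ 1 ∧
    ∃ Ms Ns : Set (Matrix (Fin m') (Fin n') D'),
      IsTypeOne Ms ∧ IsTypeTwo Ns ∧ φ A ∈ Ms ∩ Ns ∧
      φ '' {X | mrank (X - A) ≤ 1} ⊆ Ms ∪ Ns

/-- Embed a matrix `Y` as the upper-left block `diag(Y, 0)` of a (possibly) larger matrix. -/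
def embedM {R : Type} [Zero R] {a b a' b' : ℕ} (Y : Matrix (Fin a) (Fin b) R) :
    Matrix (Fin a') (Fin b') R :=
  Matrix.of fun i j => if h : i.val < a ∧ j.val < b then Y ⟨i.val, h.1⟩ ⟨j.val, h.2⟩ else 0

/-- The maximal set `M_i`: matrices whose rows other than the `i`-th are zero. -/
def rowSet (D : Type) [DivisionRing D] (m n : ℕ) (i : Fin m) :
    Set (Matrix (Fin m) (Fin n) D) :=
  {X | ∀ a j, a ≠ i → X a j = 0}

/-- The maximal set `N_j`: matrices whose columns other than the `j`-th are zero. -/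
def colSet (D : Type) [DivisionRing D] (m n : ℕ) (j : Fin n) :
    Set (Matrix (Fin m) (Fin n) D) :=
  {X | ∀ i b, b ≠ j → X i b = 0}

theorem exists_ne_three {D : Type*} (hD : (4 : Cardinal) ≤ Cardinal.mk D) (a b c : D) :
    ∃ d, d ≠ a ∧ d ≠ b ∧ d ≠ c := by
  classical
  by_contra h
  push Not at h
  have hs : (Set.univ : Set D) ⊆ (({a, b, c} : Finset D) : Set D) := by
    intro d _
    by_cases h1 : d = a
    · simp [h1]
    by_cases h2 : d = b
    · simp [h2]
    simp [h d h1 h2]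
  have h1 := Cardinal.mk_le_mk_of_subset hs
  rw [Cardinal.mk_univ] at h1
  replace h1 := h1.trans Cardinal.mk_coe_finset.le
  have h2 : ({a, b, c} : Finset D).card ≤ 3 := Finset.card_le_three
  have h3 := hD.trans h1
  have h4 : 4 ≤ ({a, b, c} : Finset D).card := by exact_mod_cast h3
  omega

/-- A Pexider-type equation over a division ring with at least four elements forces its solutions
to be semi-affine. -/
theorem exists_additive_of_pexider {D E : Type*} [DivisionRing D] [DivisionRing E]
    (hD : (4 : Cardinal) ≤ Cardinal.mk D) (G H N κ : D → E) (F : D → D → E)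
    (hF : ∀ x a b, x ≠ 0 → a ≠ 0 → b ≠ 0 → a + x * b ≠ 0 → F x (a + x * b) = G a + κ x * H b)
    (hN : ∀ x c, x ≠ 0 → c ≠ 0 → F x c = G c + κ x * N c)
    (hκ : ∀ x y, x ≠ 0 → y ≠ 0 → κ x = κ y → x = y) :
    ∃ (σ : D → E) (G₀ H₀ : E), (∀ a b, σ (a + b) = σ a + σ b) ∧
      (∀ a, a ≠ 0 → G a = σ a + G₀) ∧
      ∀ x b, x ≠ 0 → b ≠ 0 → κ x * (H b - H₀) = σ (x * b) := by
  have key : ∀ x c d, x ≠ 0 → c ≠ 0 → d ≠ 0 → c - d ≠ 0 →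
      G c - G (c - d) = κ x * (H (x⁻¹ * d) - N c) := by
    intro x c d hx hc hd hcd
    have e : c - d + x * (x⁻¹ * d) = c := by rw [mul_inv_cancel_left₀ hx]; abel
    have h1 := hF x (c - d) (x⁻¹ * d) hx hcd (mul_ne_zero (inv_ne_zero hx) hd)
      (by rw [e]; exact hc)
    rw [e, hN x c hx hc] at h1
    rw [mul_sub, sub_eq_sub_iff_add_eq_add, h1]
    abel
  obtain ⟨x₀, hx₀, hx₁, -⟩ := exists_ne_three hD 0 1 1
  have hconst : ∀ c c', c ≠ 0 → c' ≠ 0 → N c = N c' := by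
    intro c c' hc hc'
    obtain ⟨d, hd0, hdc, hdc'⟩ := exists_ne_three hD 0 c c'
    have hh : ∀ x, x ≠ 0 → κ x * (N c - N c') =
        (G c' - G (c' - d)) - (G c - G (c - d)) := by
      intro x hx
      rw [key x c d hx hc hd0 (sub_ne_zero.2 hdc.symm),
        key x c' d hx hc' hd0 (sub_ne_zero.2 hdc'.symm)]
      noncomm_ring
    have h1 := (hh x₀ hx₀).trans (hh 1 one_ne_zero).symm
    rw [← sub_eq_zero, ← sub_mul, mul_eq_zero, sub_eq_zero, sub_eq_zero] at h1
    exact h1.resolve_left fun h => hx₁ (hκ _ _ hx₀ one_ne_zero h)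
  have key' : ∀ x c d, x ≠ 0 → c ≠ 0 → d ≠ 0 → c - d ≠ 0 →
      G c - G (c - d) = κ x * (H (x⁻¹ * d) - N 1) := by
    intro x c d hx hc hd hcd
    rw [key x c d hx hc hd hcd, hconst c 1 hc one_ne_zero]
  classical
  let σ : D → E := fun d => if d = 0 then 0 else κ 1 * (H d - N 1)
  have hσ0 : σ 0 = 0 := by simp [σ]
  have hσ : ∀ c d, c ≠ 0 → c - d ≠ 0 → G c - G (c - d) = σ d := by
    intro c d hc hcd
    by_cases hd : d = 0
    · simp [hd, hσ0]
    · rw [key' 1 c d one_ne_zero hc hd hcd]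
      simp [σ, hd]
  have hadd : ∀ a b, σ (a + b) = σ a + σ b := by
    intro a b
    obtain ⟨c, hc, hca, hcab⟩ := exists_ne_three hD 0 a (a + b)
    have h1 := hσ c a hc (sub_ne_zero.2 hca)
    have h2 := hσ (c - a) b (sub_ne_zero.2 hca) (by rw [sub_sub]; exact sub_ne_zero.2 hcab)
    have h3 := hσ c (a + b) hc (sub_ne_zero.2 hcab)
    rw [sub_sub] at h2
    rw [← h1, ← h2, ← h3]
    abel
  refine ⟨σ, G 1 - σ 1, N 1, hadd, ?_, ?_⟩
  · intro a ha
    have h1 := hσ a (a - 1) ha (by simp)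
    have h2 := hadd (a - 1) 1
    rw [sub_sub_cancel] at h1
    rw [sub_add_cancel] at h2
    rw [h2, ← h1]
    abel
  · intro x b hx hb
    obtain ⟨c, hc, hcb, -⟩ := exists_ne_three hD 0 (x * b) 0
    rw [← hσ c (x * b) hc (sub_ne_zero.2 hcb),
      key' x c (x * b) hx hc (mul_ne_zero hx hb) (sub_ne_zero.2 hcb), inv_mul_cancel_left₀ hx]

/-- An injective map of (left) vector spaces over division rings which fixes the origin and maps
lines into lines. -/
structure IsLineation (D E : Type*) [DivisionRing D] [DivisionRing E] {V W : Type*}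
    [AddCommGroup V] [Module D V] [AddCommGroup W] [Module E W] (g : V → W) : Prop where
  map_zero : g 0 = 0
  injective : Function.Injective g
  map_line : ∀ (v v' : V) (t : D), ∃ α : E,
    g (t • v + (1 - t) • v') = α • g v + (1 - α) • g v'

theorem LinearIndependent.pair_eq {E W : Type*} [DivisionRing E] [AddCommGroup W] [Module E W]
    {e₁ e₂ : W} (he : LinearIndependent E ![e₁, e₂]) {a b a' b' : E}
    (h : a • e₁ + b • e₂ = a' • e₁ + b' • e₂) : a = a' ∧ b = b' := by
  rw [LinearIndependent.pair_iff] at he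
  have h1 := he (a - a') (b - b') (by
    rw [sub_smul, sub_smul, ← sub_eq_zero.2 h]; abel)
  exact ⟨sub_eq_zero.1 h1.1, sub_eq_zero.1 h1.2⟩

namespace IsLineation

variable {D E V W : Type*} [DivisionRing D] [DivisionRing E]
  [AddCommGroup V] [Module D V] [AddCommGroup W] [Module E W] {g : V → W}

theorem ne_zero (hg : IsLineation D E g) {v : V} (hv : v ≠ 0) : g v ≠ 0 := fun h =>
  hv (hg.injective (h.trans hg.map_zero.symm))

theorem coord_ne_zero (hg : IsLineation D E g) {w : V} {e : W} {φ : D → E}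
    (h : ∀ a, g (a • w) = φ a • e) (hw : w ≠ 0) {a : D} (ha : a ≠ 0) : φ a ≠ 0 := by
  intro h0
  have := h a
  rw [h0, zero_smul] at this
  exact hg.ne_zero (smul_ne_zero ha hw) this

theorem exists_ray (hD : (4 : Cardinal) ≤ Cardinal.mk D) (hg : IsLineation D E g)
    {w₁ w₂ : V} {e₁ e₂ : W} (hw : LinearIndependent D ![w₁, w₂]) {φ₁ φ₂ : D → E}
    (h₁ : ∀ a, g (a • w₁) = φ₁ a • e₁) (h₂ : ∀ a, g (a • w₂) = φ₂ a • e₂) {x : D} (hx : x ≠ 0) :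
    ∃ F κ : E, F ≠ 0 ∧ κ ≠ 0 ∧ g (w₁ + x • w₂) = F • (e₁ + κ • e₂) := by
  obtain ⟨t, ht0, ht1, -⟩ := exists_ne_three hD 0 1 1
  have ht1' : 1 - t ≠ 0 := sub_ne_zero.2 ht1.symm
  obtain ⟨α, hα⟩ := hg.map_line (t⁻¹ • w₁) (((1 - t)⁻¹ * x) • w₂) t
  rw [smul_smul, smul_smul, mul_inv_cancel₀ ht0, mul_inv_cancel_left₀ ht1', one_smul, h₁, h₂,
    smul_smul, smul_smul] at hα
  have hα0 : α ≠ 0 := by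
    intro h0
    rw [h0, zero_mul, zero_smul, zero_add, sub_zero, one_mul, ← h₂] at hα
    have h3 := hg.injective hα
    have h4 := hw.pair_eq (a := 1) (b := x) (a' := 0) (b' := (1 - t)⁻¹ * x) (by simpa using h3)
    exact one_ne_zero h4.1
  have hw1 : w₁ ≠ 0 := by simpa using hw.ne_zero 0
  have hF : α * φ₁ t⁻¹ ≠ 0 := mul_ne_zero hα0 (hg.coord_ne_zero h₁ hw1 (inv_ne_zero ht0))
  refine ⟨α * φ₁ t⁻¹, (α * φ₁ t⁻¹)⁻¹ * ((1 - α) * φ₂ ((1 - t)⁻¹ * x)), hF, ?_, ?_⟩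
  · refine mul_ne_zero (inv_ne_zero hF) (mul_ne_zero ?_ ?_)
    · intro h0
      rw [h0, ← eq_of_sub_eq_zero h0, zero_mul, zero_smul, add_zero, one_mul, ← h₁] at hα
      have h3 := hg.injective hα
      exact hx (hw.pair_eq (a := 1) (b := x) (a' := t⁻¹) (b' := 0) (by simpa using h3)).2
    · exact hg.coord_ne_zero h₂ (by simpa using hw.ne_zero 1)
        (mul_ne_zero (inv_ne_zero ht1') hx)
  · rw [hα, smul_add, smul_smul, mul_inv_cancel_left₀ hF]

/-- In inverted coordinates, a lineation of a plane preserving two axes is affine on each axis. -/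
theorem exists_additive (hD : (4 : Cardinal) ≤ Cardinal.mk D) (hg : IsLineation D E g)
    {w₁ w₂ : V} {e₁ e₂ : W} (hw : LinearIndependent D ![w₁, w₂])
    (he : LinearIndependent E ![e₁, e₂]) {φ₁ φ₂ : D → E}
    (h₁ : ∀ a, g (a • w₁) = φ₁ a • e₁) (h₂ : ∀ a, g (a • w₂) = φ₂ a • e₂) {κ : D → E}
    (hκ1 : κ 1 ≠ 0) (hκ : ∀ x, x ≠ 0 → ∀ c : D, ∃ F : E, g (c • (w₁ + x • w₂)) = F • (e₁ + κ x • e₂)) :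
    ∃ (σ : D → E) (G₀ H₀ : E), (∀ a b, σ (a + b) = σ a + σ b) ∧
      (∀ a, a ≠ 0 → (φ₁ a⁻¹)⁻¹ = σ a + G₀) ∧
      ∀ x b, x ≠ 0 → b ≠ 0 → κ x * ((φ₂ b⁻¹)⁻¹ - H₀) = σ (x * b) := by
  have hw1 : w₁ ≠ 0 := by simpa using hw.ne_zero 0
  have hw2 : w₂ ≠ 0 := by simpa using hw.ne_zero 1
  have hφ₁ : ∀ {a}, a ≠ 0 → φ₁ a ≠ 0 := hg.coord_ne_zero h₁ hw1
  have hφ₂ : ∀ {a}, a ≠ 0 → φ₂ a ≠ 0 := hg.coord_ne_zero h₂ hw2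
  have hray : ∀ x : D, w₁ + x • w₂ ≠ 0 := by
    intro x hx
    exact one_ne_zero
      (hw.pair_eq (a := 1) (b := x) (a' := 0) (b' := 0) (by simpa using hx)).1
  have hκ' : ∀ x c : D, ∃ F : E, x ≠ 0 → c ≠ 0 →
      F ≠ 0 ∧ g (c⁻¹ • (w₁ + x • w₂)) = F⁻¹ • (e₁ + κ x • e₂) := by
    intro x c
    by_cases hx : x = 0
    · exact ⟨0, fun h => absurd hx h⟩
    by_cases hc : c = 0
    · exact ⟨0, fun _ h => absurd hc h⟩
    obtain ⟨F, hF⟩ := hκ x hx c⁻¹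
    refine ⟨F⁻¹, fun _ _ => ⟨?_, by rw [hF, inv_inv]⟩⟩
    intro h
    rw [inv_eq_zero.1 h, zero_smul] at hF
    exact hg.ne_zero (smul_ne_zero (inv_ne_zero hc) (hray x)) hF
  choose F hF using hκ'
  have hN : ∀ x c, x ≠ 0 → c ≠ 0 →
      F x c = (φ₁ c⁻¹)⁻¹ + κ x * ((κ 1)⁻¹ * (F 1 c - (φ₁ c⁻¹)⁻¹)) := by
    intro x c hx hc
    obtain ⟨hFx, hgx⟩ := hF x c hx hc
    obtain ⟨hF1, hg1⟩ := hF 1 c one_ne_zero hc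
    have hp := hφ₁ (inv_ne_zero hc)
    obtain ⟨α, hα⟩ := hg.map_line (c⁻¹ • (w₁ + (1 : D) • w₂)) (c⁻¹ • w₁) (c⁻¹ * x * c)
    have e : (c⁻¹ * x * c) • (c⁻¹ • (w₁ + (1 : D) • w₂)) + (1 - c⁻¹ * x * c) • (c⁻¹ • w₁) =
        c⁻¹ • (w₁ + x • w₂) := by
      simp only [smul_add, smul_smul, sub_mul, sub_smul, mul_assoc, mul_inv_cancel₀ hc, mul_one,
        one_mul]
      abel
    rw [e, hgx, hg1, h₁] at hα
    have h3 := he.pair_eq (a := (F x c)⁻¹) (b := (F x c)⁻¹ * κ x)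
      (a' := α * (F 1 c)⁻¹ + (1 - α) * φ₁ c⁻¹) (b' := α * (F 1 c)⁻¹ * κ 1) (by
        have := hα
        simp only [smul_add, smul_smul, add_smul, mul_assoc] at this ⊢
        rw [this]; abel)
    have h4 : α = (F x c)⁻¹ * κ x * (κ 1)⁻¹ * F 1 c := by
      rw [h3.2, mul_inv_cancel_right₀ hκ1, inv_mul_cancel_right₀ hF1]
    have h5 : (1 - α) = ((F x c)⁻¹ - α * (F 1 c)⁻¹) * (φ₁ c⁻¹)⁻¹ := by
      rw [eq_mul_inv_iff_mul_eq₀ hp, h3.1]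
      abel
    have h6 : F x c * α = κ x * (κ 1)⁻¹ * F 1 c := by
      rw [h4]
      simp only [mul_assoc, mul_inv_cancel_left₀ hFx]
    have h7 : F x c - F x c * α = (1 - F x c * α * (F 1 c)⁻¹) * (φ₁ c⁻¹)⁻¹ := by
      have := congrArg (F x c * ·) h5
      simp only [mul_sub, sub_mul, mul_one, ← mul_assoc, mul_inv_cancel₀ hFx] at this ⊢
      exact this
    rw [h6, mul_inv_cancel_right₀ hF1, sub_eq_iff_eq_add] at h7
    rw [h7]
    noncomm_ring
  refine exists_additive_of_pexider hD (fun a => (φ₁ a⁻¹)⁻¹) (fun b => (φ₂ b⁻¹)⁻¹) _ κ F ?_ hN ?_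
  · intro x a b hx ha hb hc
    obtain ⟨hFx, hgx⟩ := hF x _ hx hc
    set c := a + x * b
    have hp := hφ₁ (inv_ne_zero ha)
    have hq := hφ₂ (inv_ne_zero hb)
    obtain ⟨α, hα⟩ := hg.map_line (a⁻¹ • w₁) (b⁻¹ • w₂) (c⁻¹ * a)
    have e1 : 1 - c⁻¹ * a = c⁻¹ * x * b := by
      rw [sub_eq_iff_eq_add, mul_assoc, ← mul_add, add_comm, inv_mul_cancel₀ hc]
    have e : (c⁻¹ * a) • (a⁻¹ • w₁) + (1 - c⁻¹ * a) • (b⁻¹ • w₂) = c⁻¹ • (w₁ + x • w₂) := by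
      rw [e1, smul_smul, smul_smul, mul_inv_cancel_right₀ ha, mul_inv_cancel_right₀ hb, smul_add,
        smul_smul]
    rw [e, hgx, h₁, h₂, smul_add, smul_smul, smul_smul, smul_smul] at hα
    obtain ⟨h3, h4⟩ := he.pair_eq hα
    have h5 : (F x c)⁻¹ * ((φ₁ a⁻¹)⁻¹ + κ x * (φ₂ b⁻¹)⁻¹) = 1 := by
      rw [mul_add, ← mul_assoc, h4, mul_inv_cancel_right₀ hq, h3, mul_inv_cancel_right₀ hp]
      abel
    exact (inv_mul_eq_one₀ hFx).1 h5
  · intro x y hx hy hxy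
    have h3 := hN x 1 hx one_ne_zero
    rw [hxy, ← hN y 1 hy one_ne_zero] at h3
    have h4 := (hF x 1 hx one_ne_zero).2
    rw [hxy, h3, ← (hF y 1 hy one_ne_zero).2] at h4
    have h5 := hg.injective h4
    simp only [inv_one, one_smul] at h5
    exact (hw.pair_eq (a := 1) (b := x) (a' := 1) (b' := y) (by simpa using h5)).2

end IsLineation

theorem AddMonoidHom.eq_of_add_const_eq {D E : Type*} [DivisionRing D] [AddCommGroup E]
    (hD : (4 : Cardinal) ≤ Cardinal.mk D) {s s' : D →+ E} {c c' : E}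
    (h : ∀ a, a ≠ 0 → s a + c = s' a + c') : s = s' ∧ c = c' := by
  obtain ⟨b, hb0, hb1, -⟩ := exists_ne_three hD 0 (-1) 0
  have h1 := h 1 one_ne_zero
  have h2 := h b hb0
  have h3 := h (b + 1) (fun h => hb1 (eq_neg_of_add_eq_zero_left h))
  have hc : c = c' := by
    rw [map_add, map_add] at h3
    have h4 : (s b + c) + (s 1 + c) - (s b + s 1 + c) =
      (s' b + c') + (s' 1 + c') - (s' b + s' 1 + c') := by rw [h1, h2, h3]
    have e : ∀ x y z : E, (x + z) + (y + z) - (x + y + z) = z := fun x y z => by abel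
    rwa [e, e] at h4
  subst hc
  refine ⟨AddMonoidHom.ext fun a => ?_, rfl⟩
  by_cases ha : a = 0
  · simp [ha]
  · exact add_right_cancel (h a ha)

/-- A family of lineations that preserve the same axes, and the same rays in the planes spanned by
two axes, is simultaneously semi-affine in inverted coordinates. -/
theorem IsLineation.exists_additive_family {D E V W I J : Type*} [DivisionRing D] [DivisionRing E]
    [AddCommGroup V] [Module D V] [AddCommGroup W] [Module E W] [Nonempty I] [Nontrivial J]
    (hD : (4 : Cardinal) ≤ Cardinal.mk D) {g : I → V → W} (hg : ∀ i, IsLineation D E (g i))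
    {w : J → V} {e : J → W} (hw : ∀ j k, j ≠ k → LinearIndependent D ![w j, w k])
    (he : ∀ j k, j ≠ k → LinearIndependent E ![e j, e k]) {φ : I → J → D → E}
    (hφ : ∀ i j a, g i (a • w j) = φ i j a • e j)
    (hray : ∀ j k, j ≠ k → ∀ x : D, x ≠ 0 → ∃ d : W, ∀ i (c : D), ∃ F : E,
      g i (c • (w j + x • w k)) = F • d) :
    ∃ (s : I → J → D →+ E) (c : I → J → E) (κ : J → J → D → E),
      (∀ i j a, a ≠ 0 → (φ i j a⁻¹)⁻¹ = s i j a + c i j) ∧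
      (∀ i j k x b, j ≠ k → x ≠ 0 → κ j k x * s i k b = s i j (x * b)) ∧
      ∀ i j b, b ≠ 0 → s i j b ≠ 0 := by
  have hw0 : ∀ j, w j ≠ 0 := by
    intro j
    obtain ⟨k, hk⟩ := exists_ne j
    simpa using (hw j k hk.symm).ne_zero 0
  have hκ : ∀ j k (x : D), ∃ κ : E, j ≠ k → x ≠ 0 → κ ≠ 0 ∧
      ∀ i (c : D), ∃ F : E, g i (c • (w j + x • w k)) = F • (e j + κ • e k) := by
    intro j k x
    by_cases hjk : j = k
    · exact ⟨0, fun h => absurd hjk h⟩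
    by_cases hx : x = 0
    · exact ⟨0, fun _ h => absurd hx h⟩
    let i₀ : I := Classical.arbitrary I
    obtain ⟨F₀, κ, hF₀, hκ, h₀⟩ := exists_ray hD (hg i₀) (hw j k hjk) (hφ i₀ j) (hφ i₀ k) hx
    obtain ⟨d, hd⟩ := hray j k hjk x hx
    refine ⟨κ, fun _ _ => ⟨hκ, fun i c => ?_⟩⟩
    obtain ⟨F₁, h₁⟩ := hd i₀ 1
    rw [one_smul, h₀] at h₁
    have hF₁ : F₁ ≠ 0 := by
      rintro rfl
      rw [zero_smul] at h₁
      rw [h₁] at h₀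
      have := (hw j k hjk).pair_eq (a := 1) (b := x) (a' := 0) (b' := 0)
        (by simpa using (hg i₀).injective (h₀.trans (hg i₀).map_zero.symm))
      exact one_ne_zero this.1
    obtain ⟨F, hF⟩ := hd i c
    refine ⟨F * F₁⁻¹ * F₀, ?_⟩
    rw [hF, mul_smul, h₁, smul_smul, inv_mul_cancel_right₀ hF₁]
  choose κ hκ0 hκ using hκ
  have main : ∀ i j k, ∃ (s : D →+ E) (c d : E), j ≠ k →
      (∀ a, a ≠ 0 → (φ i j a⁻¹)⁻¹ = s a + c) ∧
      ∀ x b, x ≠ 0 → b ≠ 0 → κ j k x * ((φ i k b⁻¹)⁻¹ - d) = s (x * b) := by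
    intro i j k
    by_cases hjk : j = k
    · exact ⟨0, 0, 0, fun h => absurd hjk h⟩
    obtain ⟨σ, c, d, hσ, h1, h2⟩ := exists_additive hD (hg i) (hw j k hjk) (he j k hjk)
      (hφ i j) (hφ i k) (hκ0 j k 1 hjk one_ne_zero) (fun x hx => hκ j k x hjk hx i)
    exact ⟨AddMonoidHom.mk' σ hσ, c, d, fun _ => ⟨h1, h2⟩⟩
  choose s c d hsc hsd using main
  choose p hp using fun j : J => exists_ne j
  have huniq : ∀ i j k, j ≠ k → s i j k = s i j (p j) ∧ c i j k = c i j (p j) := by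
    intro i j k hjk
    refine AddMonoidHom.eq_of_add_const_eq hD fun a ha => ?_
    rw [← hsc i j k hjk a ha, ← hsc i j (p j) (hp j).symm a ha]
  refine ⟨fun i j => s i j (p j), fun i j => c i j (p j), κ,
    fun i j => hsc i j (p j) (hp j).symm, ?_, ?_⟩
  · intro i j k x b hjk hx
    have hd : ∀ a, a ≠ 0 → s i k (p k) a + (c i k (p k) - d i j k) = (κ j k 1)⁻¹ * s i j k a := by
      intro a ha
      have h1 := hsd i j k hjk 1 a one_ne_zero ha
      rw [hsc i k (p k) (hp k).symm a ha, one_mul] at h1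
      rw [← h1, inv_mul_cancel_left₀ (hκ0 j k 1 hjk one_ne_zero)]
      abel
    have hd0 : c i k (p k) - d i j k = 0 :=
      (AddMonoidHom.eq_of_add_const_eq hD (s := s i k (p k))
        (s' := (AddMonoidHom.mulLeft (κ j k 1)⁻¹).comp (s i j k)) (c' := 0)
        fun a ha => by rw [hd a ha]; simp).2
    by_cases hb : b = 0
    · simp [hb]
    have h1 := hsd i j k hjk x b hx hb
    rw [hsc i k (p k) (hp k).symm b hb, add_sub_assoc, hd0, add_zero] at h1
    rw [h1, (huniq i j k hjk).1]
  · intro i j b hb h0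
    obtain ⟨t, ht, htb, -⟩ := exists_ne_three hD 0 (-b) 0
    have htb' : t + b ≠ 0 := fun h => htb (eq_neg_of_add_eq_zero_left h)
    have h1 := hsc i j (p j) (hp j).symm (t + b) htb'
    rw [map_add, h0, add_zero, ← hsc i j (p j) (hp j).symm t ht, _root_.inv_inj] at h1
    have h2 : g i ((t + b)⁻¹ • w j) = g i (t⁻¹ • w j) := by rw [hφ, hφ, h1]
    have h3 := smul_left_injective D (hw0 j) ((hg i).injective h2)
    simp only [_root_.inv_inj] at h3
    exact hb (by simpa using h3)

/-- A lineation which is semi-linear up to a fractional-linear factor on each of several axes has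
the same form on their span. -/
theorem IsLineation.one_add_sum_smul {D E V W J : Type*} [DivisionRing D] [DivisionRing E]
    [AddCommGroup V] [Module D V] [AddCommGroup W] [Module E W]
    (hD : (4 : Cardinal) ≤ Cardinal.mk D) {g : V → W} (hg : IsLineation D E g) {w : J → V}
    {G : J → W} (hG : LinearIndependent E G) {σ : D →+* E} {l : J → E}
    (haxis : ∀ j t, (1 + σ t * l j) • g (t • w j) = σ t • G j) (s : Finset J) (x : J → D) :
    (1 + ∑ j ∈ s, σ (x j) * l j) ≠ 0 ∧
    (1 + ∑ j ∈ s, σ (x j) * l j) • g (∑ j ∈ s, x j • w j) = ∑ j ∈ s, σ (x j) • G j := by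
  classical
  have hne : ∀ (s : Finset J) (x : J → D),
      (1 + ∑ j ∈ s, σ (x j) * l j) • g (∑ j ∈ s, x j • w j) = ∑ j ∈ s, σ (x j) • G j →
      (1 + ∑ j ∈ s, σ (x j) * l j) ≠ 0 := by
    intro s x h h0
    rw [h0, zero_smul] at h
    have h1 := linearIndependent_iff'.1 hG s (fun j => σ (x j)) h.symm
    rw [Finset.sum_eq_zero fun j hj => by rw [h1 j hj, zero_mul], add_zero] at h0
    exact one_ne_zero h0
  suffices h : ∀ (s : Finset J) (x : J → D),
      (1 + ∑ j ∈ s, σ (x j) * l j) • g (∑ j ∈ s, x j • w j) = ∑ j ∈ s, σ (x j) • G j from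
    ⟨hne s x (h s x), h s x⟩
  intro s
  induction s using Finset.induction_on with
  | empty => intro x; simp [hg.map_zero]
  | insert k s hk ih =>
    intro x
    rw [Finset.sum_insert hk, Finset.sum_insert hk, Finset.sum_insert hk]
    by_cases hy : x k = 0
    · simpa [hy] using ih x
    by_cases hs : ∑ j ∈ s, σ (x j) • G j = 0
    · have h1 := linearIndependent_iff'.1 hG s (fun j => σ (x j)) hs
      have h2 : ∀ j ∈ s, x j = 0 := fun j hj => (map_eq_zero σ).1 (h1 j hj)
      rw [Finset.sum_eq_zero fun j hj => by rw [h1 j hj, zero_mul],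
        Finset.sum_eq_zero fun j hj => by rw [h2 j hj, zero_smul], hs, add_zero, add_zero,
        add_zero, haxis]
    set v' := ∑ j ∈ s, x j • w j with hv'
    set V := ∑ j ∈ s, σ (x j) • G j with hV
    set l' := ∑ j ∈ s, σ (x j) * l j with hl'
    have hind : LinearIndependent E ![V, G k] := by
      rw [LinearIndependent.pair_iff]
      intro a b hab
      have h1 := linearIndependent_iff'.1 hG (insert k s)
        (fun j => if j = k then b else a * σ (x j)) (by
          rw [Finset.sum_insert hk, if_pos rfl, ← hab, hV, Finset.smul_sum, add_comm]
          congr 1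
          refine Finset.sum_congr rfl fun j hj => ?_
          rw [if_neg (ne_of_mem_of_not_mem hj hk), mul_smul])
      have hb : b = 0 := by simpa using h1 k (Finset.mem_insert_self k s)
      rw [hb, zero_smul, add_zero, smul_eq_zero] at hab
      exact ⟨hab.resolve_right hs, hb⟩
    have hσy : σ (x k) ≠ 0 := (map_ne_zero σ).2 hy
    have main : ∀ t : D, t ≠ 0 → t ≠ 1 → ∃ A B : E, g (x k • w k + v') = A • V + B • G k ∧
        A * (σ t + l') + B * ((σ (x k))⁻¹ * (1 - σ t) + l k) = 1 := by
      intro t ht0 ht1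
      have ht1' : 1 - t ≠ 0 := sub_ne_zero.2 ht1.symm
      have hσt : σ t ≠ 0 := (map_ne_zero σ).2 ht0
      have hσt1 : 1 - σ t ≠ 0 := by
        rw [← map_one σ, ← map_sub]; exact (map_ne_zero σ).2 ht1'
      have h1 := ih fun j => t⁻¹ * x j
      have h1' := hne s _ h1
      simp only [map_mul, mul_smul, mul_assoc, ← Finset.smul_sum, ← Finset.mul_sum, ← hv', ← hV,
        ← hl', map_inv₀] at h1 h1'
      have e1 : σ t * (1 + (σ t)⁻¹ * l') = σ t + l' := by
        rw [mul_add, mul_one, mul_inv_cancel_left₀ hσt]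
      have h2 : (σ t + l') • g (t⁻¹ • v') = V := by
        rw [← e1, mul_smul, h1, smul_inv_smul₀ hσt]
      have h2' : σ t + l' ≠ 0 := by rw [← e1]; exact mul_ne_zero hσt h1'
      have h3 := haxis k ((1 - t)⁻¹ * x k)
      have h3' : 1 + σ ((1 - t)⁻¹ * x k) * l k ≠ 0 := by
        have := hne {k} (fun _ => (1 - t)⁻¹ * x k) (by simpa using h3)
        simpa using this
      simp only [map_mul, map_inv₀, map_sub, map_one] at h3 h3'
      have e2 : (σ (x k))⁻¹ * (1 - σ t) * (1 + (1 - σ t)⁻¹ * σ (x k) * l k) =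
          (σ (x k))⁻¹ * (1 - σ t) + l k := by
        rw [mul_add, mul_one, mul_assoc, mul_assoc (1 - σ t)⁻¹, mul_inv_cancel_left₀ hσt1,
          inv_mul_cancel_left₀ hσy]
      have h4 : ((σ (x k))⁻¹ * (1 - σ t) + l k) • g (((1 - t)⁻¹ * x k) • w k) = G k := by
        rw [← e2, mul_smul, h3, smul_smul, mul_assoc, mul_inv_cancel_left₀ hσt1,
          inv_mul_cancel₀ hσy, one_smul]
      have h4' : (σ (x k))⁻¹ * (1 - σ t) + l k ≠ 0 := by
        rw [← e2]; exact mul_ne_zero (mul_ne_zero (inv_ne_zero hσy) hσt1) h3'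
      obtain ⟨α, hα⟩ := hg.map_line (t⁻¹ • v') (((1 - t)⁻¹ * x k) • w k) t
      rw [smul_inv_smul₀ ht0, smul_smul (1 - t), mul_inv_cancel_left₀ ht1', add_comm] at hα
      refine ⟨α * (σ t + l')⁻¹, (1 - α) * ((σ (x k))⁻¹ * (1 - σ t) + l k)⁻¹, ?_, ?_⟩
      · rw [hα, mul_smul α, mul_smul (1 - α), eq_inv_smul_iff₀ h2' |>.2 h2, eq_inv_smul_iff₀ h4' |>.2 h4]
      · rw [inv_mul_cancel_right₀ h2', inv_mul_cancel_right₀ h4', add_sub_cancel]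
    obtain ⟨t, ht0, ht1, -⟩ := exists_ne_three hD 0 1 1
    obtain ⟨t', ht0', ht1', htt⟩ := exists_ne_three hD 0 1 t
    obtain ⟨A, B, hAB, h1⟩ := main t ht0 ht1
    obtain ⟨A', B', hAB', h1'⟩ := main t' ht0' ht1'
    obtain ⟨rfl, rfl⟩ := hind.pair_eq (hAB.symm.trans hAB')
    have h2 : (A - B * (σ (x k))⁻¹) * (σ t - σ t') = 0 := by
      have e : (A - B * (σ (x k))⁻¹) * (σ t - σ t') =
          (A * (σ t + l') + B * ((σ (x k))⁻¹ * (1 - σ t) + l k)) -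
          (A * (σ t' + l') + B * ((σ (x k))⁻¹ * (1 - σ t') + l k)) := by noncomm_ring
      rw [e, h1, h1', sub_self]
    have h3 : A - B * (σ (x k))⁻¹ = 0 := by
      refine (mul_eq_zero.1 h2).resolve_right ?_
      rw [← map_sub]
      exact (map_ne_zero σ).2 (sub_ne_zero.2 htt.symm)
    have h4 : B = A * σ (x k) := by
      rw [sub_eq_zero.1 h3, inv_mul_cancel_right₀ hσy]
    have h5 : A * (1 + (σ (x k) * l k + l')) = 1 := by
      rw [mul_add B, ← mul_assoc B, ← sub_eq_zero.1 h3, h4] at h1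
      refine Eq.trans ?_ h1
      noncomm_ring
    have hA : A ≠ 0 := left_ne_zero_of_mul_eq_one h5
    rw [eq_inv_of_mul_eq_one_right h5, hAB, h4, mul_smul, ← smul_add, inv_smul_smul₀ hA, add_comm]

section Rank

variable {D : Type} [DivisionRing D] {m n : ℕ}

theorem mrank_le_one_iff {A : Matrix (Fin m) (Fin n) D} :
    mrank A ≤ 1 ↔ ∃ u v, A = vecMulVec u v := by
  constructor
  · intro h
    obtain ⟨v, hv⟩ := finrank_le_one_iff.1 h
    have h1 : ∀ i, ∃ c : D, c • (v : Fin n → D) = A i := fun i => by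
      obtain ⟨c, hc⟩ := hv ⟨A i, Submodule.subset_span ⟨i, rfl⟩⟩
      exact ⟨c, congrArg Subtype.val hc⟩
    choose u hu using h1
    exact ⟨u, v, by ext i j; rw [← hu i]; rfl⟩
  · rintro ⟨u, v, rfl⟩
    have h : Submodule.span D (Set.range fun i j => vecMulVec u v i j) ≤ Submodule.span D {v} := by
      rw [Submodule.span_le]
      rintro _ ⟨i, rfl⟩
      exact Submodule.mem_span_singleton.2 ⟨u i, rfl⟩
    refine (Submodule.finrank_mono h).trans ?_
    simpa using finrank_span_le_card (R := D) ({v} : Set (Fin n → D))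

theorem mrank_eq_zero_iff {A : Matrix (Fin m) (Fin n) D} : mrank A = 0 ↔ A = 0 := by
  rw [mrank, Submodule.finrank_eq_zero, Submodule.span_eq_bot]
  constructor
  · intro h
    ext i j
    exact congrFun (h _ ⟨i, rfl⟩) j
  · rintro rfl _ ⟨i, rfl⟩
    rfl

theorem vecMulVec_eq_zero_iff {R ι κ : Type*} [DivisionRing R] {u : ι → R} {v : κ → R} :
    vecMulVec u v = 0 ↔ u = 0 ∨ v = 0 := by
  simp only [← Matrix.ext_iff, vecMulVec_apply, Matrix.zero_apply, mul_eq_zero, funext_iff,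
    Pi.zero_apply, forall_or_left, forall_or_right]

theorem mrank_eq_one_iff {A : Matrix (Fin m) (Fin n) D} :
    mrank A = 1 ↔ ∃ u v, u ≠ 0 ∧ v ≠ 0 ∧ A = vecMulVec u v := by
  constructor
  · intro h
    obtain ⟨u, v, rfl⟩ := mrank_le_one_iff.1 h.le
    have h1 : vecMulVec u v ≠ 0 := fun h0 => by rw [mrank_eq_zero_iff.2 h0] at h; omega
    rw [Ne, vecMulVec_eq_zero_iff, not_or] at h1
    exact ⟨u, v, h1.1, h1.2, rfl⟩
  · rintro ⟨u, v, hu, hv, rfl⟩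
    have h1 := mrank_le_one_iff.2 ⟨u, v, rfl⟩
    have h2 : mrank (vecMulVec u v) ≠ 0 := by
      rw [Ne, mrank_eq_zero_iff, vecMulVec_eq_zero_iff, not_or]
      exact ⟨hu, hv⟩
    omega

end Rank

section Cliques

variable {E : Type*} [DivisionRing E] {ι κ : Type*}

open MulOpposite

theorem eq_op_smul_of_vecMulVec_eq {a c : ι → E} {b d : κ → E} (h : vecMulVec a b = vecMulVec c d)
    (hb : b ≠ 0) : ∃ k : E, a = op k • c := by
  obtain ⟨j, hj⟩ := Function.ne_iff.1 hb
  refine ⟨d j * (b j)⁻¹, funext fun i => ?_⟩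
  have := congrFun (congrFun h i) j
  simp only [vecMulVec_apply] at this
  rw [Pi.smul_apply, op_smul_eq_mul, ← mul_assoc, ← this, mul_inv_cancel_right₀ hj]

theorem eq_smul_of_vecMulVec_eq {a c : ι → E} {b d : κ → E} (h : vecMulVec a b = vecMulVec c d)
    (ha : a ≠ 0) : ∃ k : E, b = k • d := by
  obtain ⟨i, hi⟩ := Function.ne_iff.1 ha
  refine ⟨(a i)⁻¹ * c i, funext fun j => ?_⟩
  have := congrFun (congrFun h i) j
  simp only [vecMulVec_apply] at this
  rw [Pi.smul_apply, smul_eq_mul, mul_assoc, ← this, inv_mul_cancel_left₀ hi]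

theorem vecMulVec_zero_right (a : ι → E) : vecMulVec a (0 : κ → E) = 0 := by
  ext i j
  simp [vecMulVec_apply]

theorem vecMulVec_op_smul (k : E) (a : ι → E) (b : κ → E) :
    vecMulVec (op k • a) b = vecMulVec a (k • b) := by
  ext i j
  simp [vecMulVec_apply, mul_assoc]

theorem eq_op_smul_inv {k : E} {a c : ι → E} (h : a = op k • c) (ha : a ≠ 0) :
    k ≠ 0 ∧ c = op k⁻¹ • a := by
  have hk : k ≠ 0 := by
    rintro rfl
    exact ha (by simpa using h)
  refine ⟨hk, ?_⟩
  rw [h, smul_smul, ← op_mul, mul_inv_cancel₀ hk, op_one, one_smul]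

theorem eq_smul_inv {k : E} {a c : ι → E} (h : a = k • c) (ha : a ≠ 0) :
    k ≠ 0 ∧ c = k⁻¹ • a := by
  have hk : k ≠ 0 := by
    rintro rfl
    exact ha (by simpa using h)
  exact ⟨hk, by rw [h, inv_smul_smul₀ hk]⟩

/-- If two matrices of the form `c dᵗ` differ by such a matrix, then they share a direction. -/
theorem proportional_of_vecMulVec_sub {a c c' : ι → E} {b d d' : κ → E}
    (h : vecMulVec c d - vecMulVec c' d' = vecMulVec a b) (hc : c ≠ 0) (hd : d ≠ 0) :
    (∃ k : E, c' = op k • c) ∨ ∃ k : E, d' = k • d := by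
  obtain ⟨j, hj⟩ := Function.ne_iff.1 hd
  by_cases h1 : ∃ k : E, d' = k • d
  · exact Or.inr h1
  refine Or.inl ?_
  by_cases hc' : c' = 0
  · exact ⟨0, by simp [hc']⟩
  have h2 : vecMulVec c' (d' - (d' j * (d j)⁻¹) • d) =
      vecMulVec a ((b j * (d j)⁻¹) • d - b) := by
    ext i l
    have hl := congrFun (congrFun h i) l
    have hj' := congrFun (congrFun h i) j
    simp only [vecMulVec_apply, Matrix.sub_apply, Pi.sub_apply, Pi.smul_apply, smul_eq_mul] at *
    have e1 : c' i * d' l = c i * d l - a i * b l := by rw [← hl]; abel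
    have e2 : c' i * d' j = c i * d j - a i * b j := by rw [← hj']; abel
    rw [mul_sub, e1, ← mul_assoc, ← mul_assoc, e2, sub_mul, mul_inv_cancel_right₀ hj]
    noncomm_ring
  obtain ⟨k, hk⟩ := eq_op_smul_of_vecMulVec_eq h2
    (fun h0 => h1 ⟨_, sub_eq_zero.1 h0⟩)
  obtain ⟨hk0, hak⟩ := eq_op_smul_inv hk hc'
  have h3 : vecMulVec c d = vecMulVec c' (d' + k⁻¹ • b) := by
    rw [vecMulVec_add, ← vecMulVec_op_smul, ← hak, ← h]
    abel
  obtain ⟨l, hl⟩ := eq_op_smul_of_vecMulVec_eq h3 hd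
  exact ⟨l⁻¹, (eq_op_smul_inv hl hc).2⟩

/-- A clique through the origin consists of matrices with a common row space or a common column
space. -/
theorem exists_common_direction [Nonempty ι] {Λ : Type*} (F : Λ → Matrix ι κ E) (i₀ : Λ)
    (h0 : F i₀ = 0) (hF : ∀ i j, ∃ a b, F i - F j = vecMulVec a b) :
    (∃ c, c ≠ 0 ∧ ∀ i, ∃ r, F i = vecMulVec c r) ∨ ∃ r, r ≠ 0 ∧ ∀ i, ∃ k, F i = vecMulVec k r := by
  by_cases hz : ∀ i, F i = 0
  · refine Or.inl ⟨fun _ => 1, ?_, fun i => ⟨0, by rw [hz, vecMulVec_zero_right]⟩⟩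
    exact Function.ne_iff.2 ⟨Classical.arbitrary ι, one_ne_zero⟩
  push Not at hz
  obtain ⟨i₁, hi₁⟩ := hz
  have hF0 : ∀ i, ∃ a b, F i = vecMulVec a b := fun i => by simpa [h0] using hF i i₀
  obtain ⟨c, d, hcd⟩ := hF0 i₁
  have hc : c ≠ 0 := by rintro rfl; exact hi₁ (by rw [hcd, zero_vecMulVec])
  have hd : d ≠ 0 := by rintro rfl; exact hi₁ (by rw [hcd, vecMulVec_zero_right])
  have halt : ∀ i, (∃ r, F i = vecMulVec c r) ∨ ∃ k, F i = vecMulVec k d := by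
    intro i
    obtain ⟨c', d', h'⟩ := hF0 i
    obtain ⟨a, b, hab⟩ := hF i₁ i
    rw [hcd, h'] at hab
    rcases proportional_of_vecMulVec_sub hab hc hd with ⟨k, rfl⟩ | ⟨k, rfl⟩
    · exact Or.inl ⟨k • d', by rw [h', vecMulVec_op_smul]⟩
    · exact Or.inr ⟨op k • c', by rw [h', vecMulVec_op_smul]⟩
  by_cases hall : ∀ i, ∃ r, F i = vecMulVec c r
  · exact Or.inl ⟨c, hc, hall⟩
  by_cases hall' : ∀ i, ∃ k, F i = vecMulVec k d
  · exact Or.inr ⟨d, hd, hall'⟩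
  push Not at hall hall'
  obtain ⟨i, hi⟩ := hall
  obtain ⟨j, hj⟩ := hall'
  obtain ⟨k, hk⟩ := (halt i).resolve_left fun ⟨r, hr⟩ => hi r hr
  obtain ⟨r, hr⟩ := (halt j).resolve_right fun ⟨k, hk⟩ => hj k hk
  obtain ⟨a, b, hab⟩ := hF i j
  have hk0 : k ≠ 0 := by rintro rfl; exact hi 0 (by rw [hk, zero_vecMulVec, vecMulVec_zero_right])
  rw [hk, hr] at hab
  rcases proportional_of_vecMulVec_sub hab hk0 hd with ⟨x, hx⟩ | ⟨x, rfl⟩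
  · have h1 := (eq_op_smul_inv hx hc).2
    exact absurd (by rw [hk, h1, vecMulVec_op_smul]) (hi (x⁻¹ • d))
  · exact absurd (by rw [hr, vecMulVec_op_smul]) (hj (op x • c))

/-- In a family of matrices which is not contained in the union of two maximal sets of different
types, a single row of type two forces all rows to be of type two and all columns to be of type
one. -/
theorem common_directions_of_not_subset {X Y : Type*} (Φ : X → Y → Matrix ι κ E)
    (hΦ : ∀ x y, Φ x y ≠ 0)
    (hX : ∀ x, (∃ c, c ≠ 0 ∧ ∀ y, ∃ r, Φ x y = vecMulVec c r) ∨
      ∃ r, r ≠ 0 ∧ ∀ y, ∃ k, Φ x y = vecMulVec k r)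
    (hY : ∀ y, (∃ c, c ≠ 0 ∧ ∀ x, ∃ r, Φ x y = vecMulVec c r) ∨
      ∃ r, r ≠ 0 ∧ ∀ x, ∃ k, Φ x y = vecMulVec k r)
    (hne : ∀ c r, c ≠ 0 → r ≠ 0 → ∃ x y, (∀ s, Φ x y ≠ vecMulVec c s) ∧
      ∀ k, Φ x y ≠ vecMulVec k r)
    (hx : ∃ x r, r ≠ 0 ∧ ∀ y, ∃ k, Φ x y = vecMulVec k r) [Nonempty ι] [Nonempty κ] :
    (∀ x, ∃ r, r ≠ 0 ∧ ∀ y, ∃ k, Φ x y = vecMulVec k r) ∧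
    ∀ y, ∃ c, c ≠ 0 ∧ ∀ x, ∃ r, Φ x y = vecMulVec c r := by
  have hcol : ∀ {x x' y y' c c'}, (∀ y, ∃ r, Φ x y = vecMulVec c r) → c ≠ 0 →
      (∀ x, ∃ r, Φ x y = vecMulVec c' r) → c' ≠ 0 → (∃ r, Φ x' y' = vecMulVec c r) →
      ∃ r, Φ x' y' = vecMulVec c' r := by
    rintro x x' y y' c c' h1 hc h2 hc' ⟨r, hr⟩
    obtain ⟨s, hs⟩ := h1 y
    obtain ⟨t, ht⟩ := h2 x
    have hs0 : s ≠ 0 := by rintro rfl; exact hΦ x y (by rw [hs, vecMulVec_zero_right])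
    obtain ⟨k, rfl⟩ := eq_op_smul_of_vecMulVec_eq (hs.symm.trans ht) hs0
    exact ⟨k • r, by rw [hr, vecMulVec_op_smul]⟩
  have hcol' : ∀ {x x' y y' c c'}, (∀ y, ∃ r, Φ x y = vecMulVec c r) → c ≠ 0 →
      (∀ x, ∃ r, Φ x y = vecMulVec c' r) → c' ≠ 0 → (∃ r, Φ x' y' = vecMulVec c' r) →
      ∃ r, Φ x' y' = vecMulVec c r := by
    rintro x x' y y' c c' h1 hc h2 hc' ⟨r, hr⟩
    obtain ⟨s, hs⟩ := h1 y
    obtain ⟨t, ht⟩ := h2 x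
    have ht0 : t ≠ 0 := by rintro rfl; exact hΦ x y (by rw [ht, vecMulVec_zero_right])
    obtain ⟨k, rfl⟩ := eq_op_smul_of_vecMulVec_eq (ht.symm.trans hs) ht0
    exact ⟨k • r, by rw [hr, vecMulVec_op_smul]⟩
  have hrow : ∀ {x x' y y' c c'}, (∀ y, ∃ r, Φ x y = vecMulVec r c) → c ≠ 0 →
      (∀ x, ∃ r, Φ x y = vecMulVec r c') → c' ≠ 0 → (∃ r, Φ x' y' = vecMulVec r c) →
      ∃ r, Φ x' y' = vecMulVec r c' := by
    rintro x x' y y' c c' h1 hc h2 hc' ⟨r, hr⟩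
    obtain ⟨s, hs⟩ := h1 y
    obtain ⟨t, ht⟩ := h2 x
    have hs0 : s ≠ 0 := by rintro rfl; exact hΦ x y (by rw [hs, zero_vecMulVec])
    obtain ⟨k, rfl⟩ := eq_smul_of_vecMulVec_eq (hs.symm.trans ht) hs0
    exact ⟨op k • r, by rw [hr, vecMulVec_op_smul]⟩
  have hrow' : ∀ {x x' y y' c c'}, (∀ y, ∃ r, Φ x y = vecMulVec r c) → c ≠ 0 →
      (∀ x, ∃ r, Φ x y = vecMulVec r c') → c' ≠ 0 → (∃ r, Φ x' y' = vecMulVec r c') →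
      ∃ r, Φ x' y' = vecMulVec r c := by
    rintro x x' y y' c c' h1 hc h2 hc' ⟨r, hr⟩
    obtain ⟨s, hs⟩ := h1 y
    obtain ⟨t, ht⟩ := h2 x
    have ht0 : t ≠ 0 := by rintro rfl; exact hΦ x y (by rw [ht, zero_vecMulVec])
    obtain ⟨k, rfl⟩ := eq_smul_of_vecMulVec_eq (ht.symm.trans hs) ht0
    exact ⟨op k • r, by rw [hr, vecMulVec_op_smul]⟩
  have hone : ∃ c : ι → E, c ≠ 0 :=
    ⟨fun _ => 1, Function.ne_iff.2 ⟨Classical.arbitrary ι, one_ne_zero⟩⟩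
  have hone' : ∃ c : κ → E, c ≠ 0 :=
    ⟨fun _ => 1, Function.ne_iff.2 ⟨Classical.arbitrary κ, one_ne_zero⟩⟩
  obtain ⟨x₀, r₀, hr₀, hx₀⟩ := hx
  have hY1 : ∀ y, ∃ c, c ≠ 0 ∧ ∀ x, ∃ r, Φ x y = vecMulVec c r := by
    intro y₁
    refine (hY y₁).resolve_right ?_
    rintro ⟨r₁, hr₁, hy₁⟩
    have hXr : ∀ x r, r ≠ 0 → (∀ y, ∃ k, Φ x y = vecMulVec k r) → ∀ y, ∃ k,
        Φ x y = vecMulVec k r₁ := fun x r hr h y => hrow h hr hy₁ hr₁ (h y)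
    by_cases hX1 : ∃ x c, c ≠ 0 ∧ ∀ y, ∃ r, Φ x y = vecMulVec c r
    · obtain ⟨x₁, c₁, hc₁, hx₁⟩ := hX1
      by_cases hY1 : ∃ y c, c ≠ 0 ∧ ∀ x, ∃ r, Φ x y = vecMulVec c r
      · obtain ⟨y₂, c₂, hc₂, hy₂⟩ := hY1
        obtain ⟨x, y, h1, h2⟩ := hne c₂ r₁ hc₂ hr₁
        rcases hX x with ⟨c, hc, h⟩ | ⟨r, hr, h⟩
        · obtain ⟨s, hs⟩ := hcol h hc hy₂ hc₂ (h y)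
          exact h1 s hs
        · obtain ⟨k, hk⟩ := hXr x r hr h y
          exact h2 k hk
      · obtain ⟨c, hc⟩ := hone
        obtain ⟨x, y, h1, h2⟩ := hne c r₀ hc hr₀
        rcases hY y with h | ⟨r, hr, h⟩
        · exact hY1 ⟨y, h⟩
        · obtain ⟨k, hk⟩ := hrow' hx₀ hr₀ h hr (h x)
          exact h2 k hk
    · obtain ⟨c, hc⟩ := hone
      obtain ⟨x, y, h1, h2⟩ := hne c r₁ hc hr₁
      rcases hX x with h | ⟨r, hr, h⟩
      · exact hX1 ⟨x, h⟩
      · obtain ⟨k, hk⟩ := hXr x r hr h y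
        exact h2 k hk
  refine ⟨fun x₁ => (hX x₁).resolve_left ?_, hY1⟩
  rintro ⟨c₁, hc₁, hx₁⟩
  obtain ⟨r, hr⟩ := hone'
  obtain ⟨x, y, h1, h2⟩ := hne c₁ r hc₁ hr
  obtain ⟨c, hc, h⟩ := hY1 y
  obtain ⟨s, hs⟩ := hcol' hx₁ hc₁ h hc (h x)
  exact h1 s hs

end Cliques

section MaximalSets

variable {E : Type} [DivisionRing E] {m n : ℕ}

theorem exists_isUnit_mulVec_single {c : Fin m → E} (hc : c ≠ 0) (i : Fin m) :
    ∃ P : Matrix (Fin m) (Fin m) E, IsUnit P ∧ P *ᵥ Pi.single i 1 = c := by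
  obtain ⟨j, hj⟩ := Function.ne_iff.1 hc
  have hj : c j ≠ 0 := hj
  have h1 : (1 + vecMulVec (c - Pi.single j 1) (Pi.single j 1)) *
      (1 - vecMulVec (MulOpposite.op (c j)⁻¹ • (c - Pi.single j 1)) (Pi.single j 1)) = 1 := by
    have e : Pi.single j 1 ⬝ᵥ (MulOpposite.op (c j)⁻¹ • (c - Pi.single j 1)) = 1 - (c j)⁻¹ := by
      simp [sub_mul, mul_inv_cancel₀ hj]
    rw [vecMulVec_op_smul, add_mul, mul_sub, mul_sub, ← vecMulVec_op_smul,
      vecMulVec_mul_vecMulVec, e, vecMulVec_op_smul, sub_smul, one_smul, vecMulVec_sub, one_mul,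
      one_mul, mul_one]
    abel
  refine ⟨_ * Matrix.swap E i j, (IsUnit.of_mul_eq_one _ h1).mul
    (IsUnit.of_mul_eq_one _ (Matrix.swap_mul_self i j)), ?_⟩
  have e : Matrix.swap E i j *ᵥ Pi.single i 1 = Pi.single j 1 := by
    rw [Matrix.swap_mulVec]
    ext k
    simp [Pi.single_apply, Equiv.swap_apply_eq_iff]
  rw [← Matrix.mulVec_mulVec, e, add_mulVec, one_mulVec, vecMulVec_mulVec]
  simp

theorem exists_isUnit_vecMul_single {r : Fin n → E} (hr : r ≠ 0) (i : Fin n) :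
    ∃ Q : Matrix (Fin n) (Fin n) E, IsUnit Q ∧ Pi.single i 1 ᵥ* Q = r := by
  obtain ⟨j, hj⟩ := Function.ne_iff.1 hr
  have hj : r j ≠ 0 := hj
  have h1 : (1 + vecMulVec (Pi.single j 1) (r - Pi.single j 1)) *
      (1 - vecMulVec (Pi.single j 1) ((r j)⁻¹ • (r - Pi.single j 1))) = 1 := by
    have e : (r - Pi.single j 1) ⬝ᵥ Pi.single j 1 = r j - 1 := by simp
    rw [add_mul, mul_sub, mul_sub, vecMulVec_mul_vecMulVec, e, smul_smul, sub_mul,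
      mul_inv_cancel₀ hj, one_mul, sub_smul, one_smul, one_mul, one_mul, mul_one,
      vecMulVec_sub _ (r - _)]
    abel
  refine ⟨Matrix.swap E i j * _, (IsUnit.of_mul_eq_one _ (Matrix.swap_mul_self i j)).mul
    (IsUnit.of_mul_eq_one _ h1), ?_⟩
  have e : Pi.single i 1 ᵥ* Matrix.swap E i j = Pi.single j 1 := by
    rw [Matrix.vecMul_swap]
    ext k
    simp [Pi.single_apply, Equiv.swap_apply_eq_iff]
  rw [← Matrix.vecMul_vecMul, e, vecMul_add, vecMul_one, vecMul_vecMulVec]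
  simp

theorem isTypeOne_vecMulVec (hm : 0 < m) {c : Fin m → E} (hc : c ≠ 0)
    (B : Matrix (Fin m) (Fin n) E) : IsTypeOne {Y | ∃ r, Y - B = vecMulVec c r} := by
  obtain ⟨P, hP, rfl⟩ := exists_isUnit_mulVec_single hc ⟨0, hm⟩
  refine ⟨P, B, hP, Set.ext fun Y => ?_⟩
  simp only [Set.mem_ofPred_eq, Set.mem_image, M1set]
  constructor
  · rintro ⟨r, hr⟩
    refine ⟨vecMulVec (Pi.single ⟨0, hm⟩ 1) r, fun i j hi => ?_, ?_⟩
    · rw [vecMulVec_apply, Pi.single_eq_of_ne (fun h => hi (congrArg Fin.val h)), zero_mul]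
    · rw [mul_vecMulVec, ← hr, sub_add_cancel]
  · rintro ⟨X, hX, rfl⟩
    refine ⟨X ⟨0, hm⟩, ?_⟩
    rw [add_sub_cancel_right, ← mul_vecMulVec]
    congr 1
    ext i j
    by_cases hi : i = ⟨0, hm⟩
    · simp [hi, vecMulVec_apply]
    · rw [vecMulVec_apply, Pi.single_eq_of_ne hi, zero_mul]
      exact hX i j fun h => hi (Fin.ext h)

theorem isTypeTwo_vecMulVec (hn : 0 < n) {r : Fin n → E} (hr : r ≠ 0)
    (B : Matrix (Fin m) (Fin n) E) : IsTypeTwo {Y | ∃ k, Y - B = vecMulVec k r} := by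
  obtain ⟨Q, hQ, rfl⟩ := exists_isUnit_vecMul_single hr ⟨0, hn⟩
  refine ⟨Q, B, hQ, Set.ext fun Y => ?_⟩
  simp only [Set.mem_ofPred_eq, Set.mem_image, N1set]
  constructor
  · rintro ⟨k, hk⟩
    refine ⟨vecMulVec k (Pi.single ⟨0, hn⟩ 1), fun i j hj => ?_, ?_⟩
    · rw [vecMulVec_apply, Pi.single_eq_of_ne (fun h => hj (congrArg Fin.val h)), mul_zero]
    · rw [vecMulVec_mul, ← hk, sub_add_cancel]
  · rintro ⟨X, hX, rfl⟩
    refine ⟨fun i => X i ⟨0, hn⟩, ?_⟩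
    rw [add_sub_cancel_right, ← vecMulVec_mul]
    congr 1
    ext i j
    by_cases hj : j = ⟨0, hn⟩
    · simp [hj, vecMulVec_apply]
    · rw [vecMulVec_apply, Pi.single_eq_of_ne hj, mul_zero]
      exact hX i j fun h => hj (Fin.ext h)

end MaximalSets

section Homomorphism

variable {m n m' n' : ℕ} {D E : Type} [DivisionRing D] [DivisionRing E]

/-- A graph homomorphism fixing the origin such that, around every matrix of rank at most one,
adjacent matrices with a common column direction are sent to a common row direction and vice
versa. -/
structure IsTransposing (θ : Matrix (Fin m) (Fin n) D → Matrix (Fin m') (Fin n') E) : Prop where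
  map_zero : θ 0 = 0
  adj : ∀ X Y, mrank (X - Y) = 1 → mrank (θ X - θ Y) = 1
  row : ∀ a b x, x ≠ 0 → ∃ r, r ≠ 0 ∧ ∀ y, ∃ k,
    θ (vecMulVec a b + vecMulVec x y) - θ (vecMulVec a b) = vecMulVec k r
  col : ∀ a b y, y ≠ 0 → ∃ c, c ≠ 0 ∧ ∀ x, ∃ r,
    θ (vecMulVec a b + vecMulVec x y) - θ (vecMulVec a b) = vecMulVec c r

variable {θ : Matrix (Fin m) (Fin n) D → Matrix (Fin m') (Fin n') E}

theorem exists_notMem_of_not_degenerate (hm' : 0 < m') (hn' : 0 < n') (hnd : ¬ Degenerate θ)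
    {A : Matrix (Fin m) (Fin n) D} (hA : mrank A ≤ 1) {c : Fin m' → E} {r : Fin n' → E}
    (hc : c ≠ 0) (hr : r ≠ 0) : ∃ X, mrank (X - A) ≤ 1 ∧ (∀ s, θ X - θ A ≠ vecMulVec c s) ∧
      ∀ k, θ X - θ A ≠ vecMulVec k r := by
  by_contra h
  push Not at h
  refine hnd ⟨A, hA, _, _, isTypeOne_vecMulVec hm' hc (θ A), isTypeTwo_vecMulVec hn' hr (θ A),
    ⟨⟨0, ?_⟩, ⟨0, ?_⟩⟩, ?_⟩
  · rw [sub_self, vecMulVec_zero_right]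
  · rw [sub_self, zero_vecMulVec]
  · rintro _ ⟨X, hX, rfl⟩
    by_cases h1 : ∃ s, θ X - θ A = vecMulVec c s
    · exact Or.inl h1
    · push Not at h1
      exact Or.inr (h X hX h1)

theorem exists_sub_eq_vecMulVec (hhom : ∀ X Y, mrank (X - Y) = 1 → mrank (θ X - θ Y) = 1)
    {X Y : Matrix (Fin m) (Fin n) D} (h : ∃ u v, X - Y = vecMulVec u v) :
    ∃ a b, θ X - θ Y = vecMulVec a b := by
  by_cases hXY : X = Y
  · exact ⟨0, 0, by rw [hXY, sub_self, zero_vecMulVec]⟩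
  · have h1 := mrank_le_one_iff.2 h
    have h2 : mrank (X - Y) ≠ 0 := fun h => hXY (sub_eq_zero.1 (mrank_eq_zero_iff.1 h))
    exact mrank_le_one_iff.1 (hhom X Y (by omega)).le

theorem common_directions_of_not_degenerate (hm' : 0 < m') (hn' : 0 < n')
    (hhom : ∀ X Y, mrank (X - Y) = 1 → mrank (θ X - θ Y) = 1)
    (hnd : ¬ Degenerate θ) {A : Matrix (Fin m) (Fin n) D} (hA : mrank A ≤ 1)
    (hx : ∃ x, x ≠ 0 ∧ ∃ r, r ≠ 0 ∧ ∀ y, ∃ k, θ (A + vecMulVec x y) - θ A = vecMulVec k r) :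
    (∀ x, x ≠ 0 → ∃ r, r ≠ 0 ∧ ∀ y, ∃ k, θ (A + vecMulVec x y) - θ A = vecMulVec k r) ∧
    ∀ y, y ≠ 0 → ∃ c, c ≠ 0 ∧ ∀ x, ∃ r, θ (A + vecMulVec x y) - θ A = vecMulVec c r := by
  have : Nonempty (Fin m') := ⟨⟨0, hm'⟩⟩
  have : Nonempty (Fin n') := ⟨⟨0, hn'⟩⟩
  have key := common_directions_of_not_subset
    (X := {x : Fin m → D // x ≠ 0}) (Y := {y : Fin n → D // y ≠ 0})
    (fun x y => θ (A + vecMulVec x.1 y.1) - θ A) ?_ ?_ ?_ ?_ ?_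
  · constructor
    · intro x hx
      obtain ⟨r, hr, h⟩ := key.1 ⟨x, hx⟩
      refine ⟨r, hr, fun y => ?_⟩
      by_cases hy : y = 0
      · exact ⟨0, by rw [hy, vecMulVec_zero_right, add_zero, sub_self, zero_vecMulVec]⟩
      · exact h ⟨y, hy⟩
    · intro y hy
      obtain ⟨c, hc, h⟩ := key.2 ⟨y, hy⟩
      refine ⟨c, hc, fun x => ?_⟩
      by_cases hx : x = 0
      · exact ⟨0, by rw [hx, zero_vecMulVec, add_zero, sub_self, vecMulVec_zero_right]⟩
      · exact h ⟨x, hx⟩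
  · intro x y h0
    have := hhom (A + vecMulVec x.1 y.1) A
      (mrank_eq_one_iff.2 ⟨x, y, x.2, y.2, add_sub_cancel_left _ _⟩)
    rw [mrank_eq_zero_iff.2 h0] at this
    omega
  · intro x
    have h := exists_common_direction (fun y => θ (A + vecMulVec x.1 y) - θ A) 0
      (by simp only [vecMulVec_zero_right, add_zero, sub_self]) (fun y y' => by
        rw [sub_sub_sub_cancel_right]
        exact exists_sub_eq_vecMulVec hhom ⟨x.1, y - y', by
          rw [add_sub_add_left_eq_sub, vecMulVec_sub]⟩)
    exact h.imp (fun ⟨c, hc, h⟩ => ⟨c, hc, fun y => h y⟩) fun ⟨c, hc, h⟩ => ⟨c, hc, fun y => h y⟩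
  · intro y
    have h := exists_common_direction (fun x => θ (A + vecMulVec x y.1) - θ A) 0
      (by simp only [zero_vecMulVec, add_zero, sub_self]) (fun x x' => by
        rw [sub_sub_sub_cancel_right]
        exact exists_sub_eq_vecMulVec hhom ⟨x - x', y.1, by
          rw [add_sub_add_left_eq_sub, sub_vecMulVec]⟩)
    exact h.imp (fun ⟨c, hc, h⟩ => ⟨c, hc, fun y => h y⟩) fun ⟨c, hc, h⟩ => ⟨c, hc, fun y => h y⟩
  · intro c r hc hr
    obtain ⟨X, hX, h1, h2⟩ := exists_notMem_of_not_degenerate hm' hn' hnd hA hc hr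
    obtain ⟨x, y, hxy⟩ := mrank_le_one_iff.1 hX
    obtain rfl : X = A + vecMulVec x y := by rw [← hxy, add_sub_cancel]
    have hne : vecMulVec x y ≠ 0 := by
      intro h0
      exact h1 0 (by rw [h0, add_zero, sub_self, vecMulVec_zero_right])
    rw [Ne, vecMulVec_eq_zero_iff, not_or] at hne
    exact ⟨⟨x, hne.1⟩, ⟨y, hne.2⟩, h1, h2⟩
  · obtain ⟨x, hx0, r, hr, h⟩ := hx
    exact ⟨⟨x, hx0⟩, r, hr, fun y => h y⟩

theorem isTransposing_of_not_degenerate (hm : 0 < m) (hm' : 0 < m') (hn' : 0 < n') (hn : m ≤ n')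
    (hhom : ∀ X Y, mrank (X - Y) = 1 → mrank (θ X - θ Y) = 1)
    (hnd : ¬ Degenerate θ) (h0 : θ 0 = 0)
    (hrow : ∀ i : Fin m, θ '' rowSet D m n i ⊆ colSet E m' n' (Fin.castLE hn i)) :
    IsTransposing θ := by
  have hrow0 : ∀ x : Fin m → D, x ≠ 0 → ∃ r, r ≠ 0 ∧ ∀ y, ∃ k, θ (vecMulVec x y) = vecMulVec k r := by
    have := common_directions_of_not_degenerate hm' hn' hhom hnd (A := 0)
      (mrank_le_one_iff.2 ⟨0, 0, (zero_vecMulVec _).symm⟩)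
      ⟨Pi.single ⟨0, hm⟩ 1, by simp, Pi.single (Fin.castLE hn ⟨0, hm⟩) 1, by simp, fun y => ?_⟩
    · simpa only [zero_add, h0, sub_zero] using this.1
    · rw [zero_add, h0, sub_zero]
      have h1 := hrow ⟨0, hm⟩ ⟨vecMulVec (Pi.single ⟨0, hm⟩ 1) y, fun a j ha => by
        rw [vecMulVec_apply, Pi.single_eq_of_ne ha, zero_mul], rfl⟩
      refine ⟨fun i => θ (vecMulVec (Pi.single ⟨0, hm⟩ 1) y) i (Fin.castLE hn ⟨0, hm⟩), ?_⟩
      ext i j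
      rw [vecMulVec_apply]
      by_cases hj : j = Fin.castLE hn ⟨0, hm⟩
      · rw [hj, Pi.single_eq_same, mul_one]
      · rw [Pi.single_eq_of_ne hj, mul_zero]
        exact h1 i j hj
  have hall : ∀ a b, (∀ x, x ≠ 0 → ∃ r, r ≠ 0 ∧ ∀ y, ∃ k,
      θ (vecMulVec a b + vecMulVec x y) - θ (vecMulVec a b) = vecMulVec k r) ∧
      ∀ y, y ≠ 0 → ∃ c, c ≠ 0 ∧ ∀ x, ∃ r,
      θ (vecMulVec a b + vecMulVec x y) - θ (vecMulVec a b) = vecMulVec c r := by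
    intro a b
    refine common_directions_of_not_degenerate hm' hn' hhom hnd (mrank_le_one_iff.2 ⟨a, b, rfl⟩) ?_
    by_cases ha : a = 0
    · subst ha
      obtain ⟨r, hr, h⟩ := hrow0 (Pi.single ⟨0, hm⟩ 1) (by simp)
      refine ⟨Pi.single ⟨0, hm⟩ 1, by simp, r, hr, fun y => ?_⟩
      simpa only [zero_vecMulVec, zero_add, h0, sub_zero] using h y
    · obtain ⟨r, hr, h⟩ := hrow0 a ha
      refine ⟨a, ha, r, hr, fun y => ?_⟩
      obtain ⟨k, hk⟩ := h (b + y)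
      obtain ⟨k', hk'⟩ := h b
      exact ⟨k - k', by rw [← vecMulVec_add, hk, hk', sub_vecMulVec]⟩
  exact ⟨h0, hhom, fun a b => (hall a b).1, fun a b => (hall a b).2⟩

namespace IsTransposing

theorem exists_row (h : IsTransposing θ) {u : Fin m → D} (hu : u ≠ 0) :
    ∃ r, r ≠ 0 ∧ ∀ v, ∃ k, θ (vecMulVec u v) = vecMulVec k r := by
  simpa [h.map_zero] using h.row 0 0 u hu

theorem exists_col (h : IsTransposing θ) {v : Fin n → D} (hv : v ≠ 0) :
    ∃ c, c ≠ 0 ∧ ∀ u, ∃ r, θ (vecMulVec u v) = vecMulVec c r := by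
  simpa [h.map_zero] using h.col 0 0 v hv

theorem injective_on_row (h : IsTransposing θ) {u u' : Fin m → D} {v v' : Fin n → D}
    (huv : ∃ a b, a ≠ 0 ∧ b ≠ 0 ∧ vecMulVec u v - vecMulVec u' v' = vecMulVec a b) :
    θ (vecMulVec u v) ≠ θ (vecMulVec u' v') := by
  intro heq
  have := h.adj _ _ (mrank_eq_one_iff.2 huv)
  rw [heq, sub_self, mrank_eq_zero_iff.2 rfl] at this
  omega

theorem isLineation_row (h : IsTransposing θ) {u : Fin m → D} (hu : u ≠ 0)
    {r : Fin n' → E} (hr : r ≠ 0) {k : (Fin n → D) → Fin m' → E}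
    (hk : ∀ v, θ (vecMulVec u v) = vecMulVec (k v) r) : IsLineation D Eᵐᵒᵖ k := by
  refine ⟨?_, ?_, ?_⟩
  · have h1 := hk 0
    rw [vecMulVec_zero_right, h.map_zero, eq_comm, vecMulVec_eq_zero_iff] at h1
    exact h1.resolve_right hr
  · intro v v' hvv
    by_contra hne
    refine h.injective_on_row ⟨u, v - v', hu, sub_ne_zero.2 hne, (vecMulVec_sub _ _ _).symm⟩ ?_
    rw [hk, hk, hvv]
  · intro v v' t
    by_cases hvv : v = v'
    · subst hvv
      exact ⟨1, by rw [← add_smul]; simp⟩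
    obtain ⟨c, hc, hx⟩ := h.col u v' (v - v') (sub_ne_zero.2 hvv)
    have hmem : ∀ w : D, ∃ γ : E, k (w • (v - v') + v') - k v' = MulOpposite.op γ • c := by
      intro w
      obtain ⟨s, hs⟩ := hx (MulOpposite.op w • u)
      rw [vecMulVec_op_smul, ← vecMulVec_add, hk, hk, ← sub_vecMulVec, add_comm v'] at hs
      exact eq_op_smul_of_vecMulVec_eq hs hr
    obtain ⟨γ₁, h1⟩ := hmem 1
    obtain ⟨γ, h2⟩ := hmem t
    rw [one_smul, sub_add_cancel] at h1
    have hne : k v - k v' ≠ 0 := by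
      refine sub_ne_zero.2 fun heq => ?_
      refine h.injective_on_row ⟨u, v - v', hu, sub_ne_zero.2 hvv, (vecMulVec_sub _ _ _).symm⟩ ?_
      rw [hk, hk, heq]
    obtain ⟨-, h3⟩ := eq_op_smul_inv h1 hne
    refine ⟨MulOpposite.op γ * MulOpposite.op γ₁⁻¹, ?_⟩
    have e : t • v + (1 - t) • v' = t • (v - v') + v' := by
      rw [sub_smul, one_smul, smul_sub]; abel
    have h4 : k (t • (v - v') + v') - k v' =
        (MulOpposite.op γ * MulOpposite.op γ₁⁻¹) • (k v - k v') := by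
      rw [h2, mul_smul, ← h3]
    rw [e, sub_smul, one_smul, ← sub_add_cancel (k (t • (v - v') + v')) (k v'), h4, smul_sub]
    abel

theorem isLineation_col (h : IsTransposing θ) {v : Fin n → D} (hv : v ≠ 0)
    {c : Fin m' → E} (hc : c ≠ 0) {l : (Fin m → D) → Fin n' → E}
    (hl : ∀ u, θ (vecMulVec u v) = vecMulVec c (l u)) : IsLineation Dᵐᵒᵖ E l := by
  refine ⟨?_, ?_, ?_⟩
  · have h1 := hl 0
    rw [zero_vecMulVec, h.map_zero, eq_comm, vecMulVec_eq_zero_iff] at h1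
    exact h1.resolve_left hc
  · intro u u' huu
    by_contra hne
    refine h.injective_on_row ⟨u - u', v, sub_ne_zero.2 hne, hv, (sub_vecMulVec _ _ _).symm⟩ ?_
    rw [hl, hl, huu]
  · intro u u' t
    by_cases huu : u = u'
    · subst huu
      exact ⟨1, by rw [← add_smul]; simp⟩
    obtain ⟨r, hr, hx⟩ := h.row u' v (u - u') (sub_ne_zero.2 huu)
    have hmem : ∀ w : Dᵐᵒᵖ, ∃ γ : E, l (w • (u - u') + u') - l u' = γ • r := by
      intro w
      obtain ⟨s, hs⟩ := hx (w.unop • v)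
      rw [← vecMulVec_op_smul, ← add_vecMulVec, hl, hl, ← vecMulVec_sub, add_comm u'] at hs
      exact eq_smul_of_vecMulVec_eq hs hc
    obtain ⟨γ₁, h1⟩ := hmem 1
    obtain ⟨γ, h2⟩ := hmem t
    rw [one_smul, sub_add_cancel] at h1
    have hne : l u - l u' ≠ 0 := by
      refine sub_ne_zero.2 fun heq => ?_
      refine h.injective_on_row ⟨u - u', v, sub_ne_zero.2 huu, hv, (sub_vecMulVec _ _ _).symm⟩ ?_
      rw [hl, hl, heq]
    obtain ⟨-, h3⟩ := eq_smul_inv h1 hne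
    refine ⟨γ * γ₁⁻¹, ?_⟩
    have e : t • u + (1 - t) • u' = t • (u - u') + u' := by
      rw [sub_smul, one_smul, smul_sub]; abel
    have h4 : l (t • (u - u') + u') - l u' = (γ * γ₁⁻¹) • (l u - l u') := by
      rw [h2, mul_smul, ← h3]
    rw [e, sub_smul, one_smul, ← sub_add_cancel (l (t • (u - u') + u')) (l u'), h4, smul_sub]
    abel

end IsTransposing

end Homomorphism

section Extension

open MulOpposite

theorem LinearIndependent.not_pair_smul {R V : Type*} [DivisionRing R] [AddCommGroup V] [Module R V]
    {a b c : V} (h : LinearIndependent R ![a, b]) (ha : ∃ k : R, a = k • c) (hb : ∃ k : R, b = k • c) :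
    False := by
  obtain ⟨k, rfl⟩ := ha
  obtain ⟨l, rfl⟩ := hb
  have hk : k ≠ 0 := by
    rintro rfl
    exact h.ne_zero 0 (by simp)
  have := h.pair_eq (a := l * k⁻¹) (b := 0) (a' := 0) (b' := 1)
    (by rw [smul_smul, inv_mul_cancel_right₀ hk]; simp)
  exact zero_ne_one this.2

section Vectors

variable {E ι κ : Type*} [DivisionRing E]

theorem exists_op_smul_of_smul {a c : ι → E} (h : ∃ k : E, a = op k • c) : ∃ k : Eᵐᵒᵖ, a = k • c :=
  h.imp' op fun _ h => h

theorem proportional_of_vecMulVec_sub_eq {α c₁ c₂ : ι → E} {x d₁ d₂ : κ → E}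
    (h : vecMulVec c₁ d₁ - vecMulVec c₂ d₂ = vecMulVec α x) (hc : c₁ ≠ 0) (hd : d₁ ≠ 0)
    (hx : x ≠ 0) : (∃ k : E, α = op k • c₁) ∨ ∃ k : E, x = k • d₁ := by
  by_cases hα : α = 0
  · exact Or.inl ⟨0, by simp [hα]⟩
  rcases proportional_of_vecMulVec_sub h hc hd with ⟨k, rfl⟩ | ⟨k, rfl⟩
  · rw [vecMulVec_op_smul, ← vecMulVec_sub] at h
    exact Or.inl (eq_op_smul_of_vecMulVec_eq h.symm hx)
  · rw [← vecMulVec_op_smul, ← sub_vecMulVec] at h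
    exact Or.inr (eq_smul_of_vecMulVec_eq h.symm hα)

/-- If three translates of a matrix have the form `c dᵗ`, then the directions of the
translations are related to those of the first translate. -/
theorem proportional_of_translates {W : Matrix ι κ E} {α₁ α₂ c₁ : ι → E} {x₁ x₂ d₁ : κ → E}
    (h₁ : W - vecMulVec α₂ x₂ = vecMulVec c₁ d₁) (hc : c₁ ≠ 0) (hd : d₁ ≠ 0) (hx₁ : x₁ ≠ 0)
    (hx₂ : x₂ ≠ 0) (h₂ : ∃ c d, W - vecMulVec (α₂ - α₁) x₂ = vecMulVec c d)
    (h₃ : ∃ c d, W - vecMulVec α₂ (x₂ - x₁) = vecMulVec c d) :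
    ((∃ k : E, α₁ = op k • c₁) ∨ ∃ k : E, x₂ = k • d₁) ∧
      ((∃ k : E, α₂ = op k • c₁) ∨ ∃ k : E, x₁ = k • d₁) := by
  obtain ⟨c₂, d₂, h₂⟩ := h₂
  obtain ⟨c₃, d₃, h₃⟩ := h₃
  constructor
  · have h : vecMulVec c₁ d₁ - vecMulVec c₂ d₂ = vecMulVec α₁ (-x₂) := by
      rw [← h₁, ← h₂, sub_vecMulVec, vecMulVec_neg]; abel
    refine (proportional_of_vecMulVec_sub_eq h hc hd (neg_ne_zero.2 hx₂)).imp_right ?_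
    rintro ⟨k, hk⟩
    exact ⟨-k, by rw [neg_smul, ← hk, neg_neg]⟩
  · have h : vecMulVec c₁ d₁ - vecMulVec c₃ d₃ = vecMulVec α₂ (-x₁) := by
      rw [← h₁, ← h₃, vecMulVec_sub, vecMulVec_neg]; abel
    refine (proportional_of_vecMulVec_sub_eq h hc hd (neg_ne_zero.2 hx₁)).imp_right ?_
    rintro ⟨k, hk⟩
    exact ⟨-k, by rw [neg_smul, ← hk, neg_neg]⟩

/-- A sum of two independent matrices of rank one does not have rank one. -/
theorem vecMulVec_add_vecMulVec_ne {y₁ y₂ c : ι → E} {x₁ x₂ d : κ → E}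
    (hy : LinearIndependent Eᵐᵒᵖ ![y₁, y₂]) (hx : LinearIndependent E ![x₁, x₂]) :
    vecMulVec y₁ x₁ + vecMulVec y₂ x₂ ≠ vecMulVec c d := by
  intro h
  have hy1 : y₁ ≠ 0 := by simpa using hy.ne_zero 0
  have hx1 : x₁ ≠ 0 := by simpa using hx.ne_zero 0
  have hy2 : y₂ ≠ 0 := by simpa using hy.ne_zero 1
  have hx2 : x₂ ≠ 0 := by simpa using hx.ne_zero 1
  have h' : vecMulVec y₁ x₁ - vecMulVec c d = vecMulVec (-y₂) x₂ := by
    rw [← h, neg_vecMulVec]; abel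
  rcases proportional_of_vecMulVec_sub_eq h' hy1 hx1 hx2 with ⟨k, hk⟩ | ⟨k, hk⟩
  · refine hy.not_pair_smul (c := y₁) ⟨1, (one_smul _ _).symm⟩ ⟨op (-k), ?_⟩
    rw [op_neg, neg_smul, ← hk, neg_neg]
  · exact hx.not_pair_smul (c := x₁) ⟨1, (one_smul _ _).symm⟩ ⟨k, hk⟩

theorem eq_vecMulVec_of_proportional {c : ι → E} {d : κ → E} {y : ι → E} {x : κ → E}
    (hy0 : y ≠ 0) (hx0 : x ≠ 0)
    (hy : ∃ k : E, y = op k • c) (hx : ∃ k : E, x = k • d) :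
    ∃ k : E, vecMulVec c d = vecMulVec y (k • x) := by
  obtain ⟨k, hk⟩ := hy
  obtain ⟨l, hl⟩ := hx
  obtain ⟨-, h1⟩ := eq_op_smul_inv hk hy0
  obtain ⟨-, h2⟩ := eq_smul_inv hl hx0
  exact ⟨k⁻¹ * l⁻¹, by rw [h1, h2, vecMulVec_op_smul, smul_smul]⟩

theorem vecMulVec_eq_of_translates {V : Matrix ι κ E} {y₁ y₂ c₁ : ι → E} {x₁ x₂ d₁ : κ → E}
    (hy : LinearIndependent Eᵐᵒᵖ ![y₁, y₂]) (hx : LinearIndependent E ![x₁, x₂])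
    (h₁ : V - vecMulVec y₂ x₂ = vecMulVec c₁ d₁) (hc : c₁ ≠ 0) (hd : d₁ ≠ 0)
    (h₂ : ∃ c d, V - vecMulVec (y₂ - y₁) x₂ = vecMulVec c d)
    (h₃ : ∃ c d, V - vecMulVec y₂ (x₂ - x₁) = vecMulVec c d) :
    (∃ k : E, V = vecMulVec y₂ x₂ + vecMulVec y₁ (k • x₁)) ∨
      ∃ k : E, V = vecMulVec y₂ (k • x₂) := by
  have hy1 : y₁ ≠ 0 := by simpa using hy.ne_zero 0
  have hx1 : x₁ ≠ 0 := by simpa using hx.ne_zero 0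
  have hy2 : y₂ ≠ 0 := by simpa using hy.ne_zero 1
  have hx2 : x₂ ≠ 0 := by simpa using hx.ne_zero 1
  obtain ⟨h4, h5⟩ := proportional_of_translates h₁ hc hd hx1 hx2 h₂ h₃
  rcases h4 with h4 | h4 <;> rcases h5 with h5 | h5
  · exact (hy.not_pair_smul (exists_op_smul_of_smul h4) (exists_op_smul_of_smul h5)).elim
  · obtain ⟨k, hk⟩ := eq_vecMulVec_of_proportional hy1 hx1 h4 h5
    exact Or.inl ⟨k, by rw [← hk, ← h₁]; abel⟩
  · obtain ⟨k, hk⟩ := eq_vecMulVec_of_proportional hy2 hx2 h5 h4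
    exact Or.inr ⟨1 + k, by rw [add_smul, one_smul, vecMulVec_add, ← hk, ← h₁]; abel⟩
  · exact (hx.not_pair_smul h5 h4).elim

theorem eq_zero_or_eq_of_translates {V : Matrix ι κ E} {y₁ y₂ : ι → E} {x₁ x₂ : κ → E}
    (hy : LinearIndependent Eᵐᵒᵖ ![y₁, y₂]) (hx : LinearIndependent E ![x₁, x₂])
    (h₁ : (∃ k : E, V = vecMulVec y₂ x₂ + vecMulVec y₁ (k • x₁)) ∨
      ∃ k : E, V = vecMulVec y₂ (k • x₂))
    (h₂ : (∃ k : E, V = vecMulVec y₁ x₁ + vecMulVec y₂ (k • x₂)) ∨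
      ∃ k : E, V = vecMulVec y₁ (k • x₁)) :
    V = 0 ∨ V = vecMulVec y₁ x₁ + vecMulVec y₂ x₂ := by
  have hx1 : x₁ ≠ 0 := by simpa using hx.ne_zero 0
  have hx2 : x₂ ≠ 0 := by simpa using hx.ne_zero 1
  have key : ∀ r s : E, vecMulVec y₁ (r • x₁) = vecMulVec y₂ (s • x₂) → r = 0 ∧ s = 0 := by
    intro r s h
    by_contra h0
    by_cases hr : r = 0
    · have hs : s ≠ 0 := fun hs => h0 ⟨hr, hs⟩
      rw [hr, zero_smul, vecMulVec_zero_right, eq_comm, vecMulVec_eq_zero_iff] at h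
      exact h.elim (fun h => hy.ne_zero 1 h) (smul_ne_zero hs hx2)
    · obtain ⟨k, hk⟩ := eq_op_smul_of_vecMulVec_eq h (smul_ne_zero hr hx1)
      exact hy.not_pair_smul (exists_op_smul_of_smul ⟨k, hk⟩) ⟨1, (one_smul _ _).symm⟩
  rcases h₁ with ⟨k, hk⟩ | ⟨k, hk⟩ <;> rcases h₂ with ⟨l, hl⟩ | ⟨l, hl⟩
  · have h : vecMulVec y₁ ((k - 1) • x₁) = vecMulVec y₂ ((l - 1) • x₂) := by
      have := hk.symm.trans hl
      rw [sub_smul, sub_smul, one_smul, one_smul, vecMulVec_sub, vecMulVec_sub,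
        sub_eq_sub_iff_add_eq_add, add_comm, this, add_comm]
    rw [hl, sub_eq_zero.1 (key _ _ h).2, one_smul]
    exact Or.inr rfl
  · have h : vecMulVec y₁ ((l - k) • x₁) = vecMulVec y₂ ((1 : E) • x₂) := by
      rw [sub_smul, vecMulVec_sub, one_smul, ← hl, hk, add_sub_cancel_right]
    exact absurd (key _ _ h).2 one_ne_zero
  · have h : vecMulVec y₁ ((1 : E) • x₁) = vecMulVec y₂ ((k - l) • x₂) := by
      rw [sub_smul, vecMulVec_sub, one_smul, ← hk, hl, add_sub_cancel_right]
    exact absurd (key _ _ h).1 one_ne_zero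
  · rw [hl, (key _ _ (hl.symm.trans hk)).1, zero_smul, vecMulVec_zero_right]
    exact Or.inl rfl

end Vectors

end Extension

section Fraction

open MulOpposite

theorem proportional_of_sub_vecMulVec {E ι κ : Type*} [DivisionRing E] {W : Matrix ι κ E} {β c₁ c₂ : ι → E} {x₁ x₂ d₁ d₂ : κ → E}
    (h₁ : W - vecMulVec β x₂ = vecMulVec c₁ d₁) (h₂ : W = vecMulVec c₂ d₂) (hβ : β ≠ 0)
    (hx₁ : x₁ ≠ 0) (hd₁ : ∃ k : E, x₁ = k • d₁) (hd₂ : ∃ k : E, x₁ = k • d₂) :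
    ∃ k : E, x₂ = k • x₁ := by
  obtain ⟨k, hk⟩ := hd₁
  obtain ⟨l, hl⟩ := hd₂
  rw [(eq_smul_inv hk hx₁).2, ← vecMulVec_op_smul] at h₁
  rw [(eq_smul_inv hl hx₁).2, ← vecMulVec_op_smul] at h₂
  rw [h₂, sub_eq_iff_eq_add, ← sub_eq_iff_eq_add', ← sub_vecMulVec] at h₁
  exact eq_smul_of_vecMulVec_eq h₁.symm hβ

variable {E ι κ : Type*} [DivisionRing E] [Fintype ι] [Fintype κ] {L : Matrix κ ι E}
  {Y Z Y₁ Z₁ : Matrix ι κ E}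

theorem isUnit_of_eq_mulVec [DecidableEq ι] {c t : ι → E} {d : κ → E} (h : Z - (1 - Z * L) * Y = vecMulVec c d)
    (hc : c = (1 - Z * L) *ᵥ t) : IsUnit (1 - Z * L) := by
  have h1 : Z = (1 - Z * L) * (Y + vecMulVec t d) := by
    rw [Matrix.mul_add, mul_vecMulVec, ← hc, ← h, add_sub_cancel]
  have h2 : (1 - Z * L) * (1 + (Y + vecMulVec t d) * L) = 1 := by
    rw [Matrix.mul_add, ← Matrix.mul_assoc, ← h1, Matrix.mul_one, sub_add_cancel]
  exact IsUnit.of_mul_eq_one _ h2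

variable [DecidableEq κ]

theorem one_sub_mul_one_add_of_fraction (h : Z * (1 + L * Y) = Y) :
    (1 - L * Z) * (1 + L * Y) = 1 := by
  rw [sub_mul, Matrix.mul_assoc, h, one_mul, add_sub_cancel_right]

theorem one_add_mul_one_sub_of_fraction (h : Z * (1 + L * Y) = Y) :
    (1 + L * Y) * (1 - L * Z) = 1 :=
  mul_eq_one_comm.1 (one_sub_mul_one_add_of_fraction h)

theorem fraction_unique (h : Z * (1 + L * Y) = Y) (h₁ : Z₁ * (1 + L * Y) = Y) : Z = Z₁ := by
  have := congrArg (· * (1 - L * Z)) (h.trans h₁.symm)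
  simpa only [Matrix.mul_assoc, one_add_mul_one_sub_of_fraction h, Matrix.mul_one] using this

variable [DecidableEq ι]

theorem one_sub_mul_one_add_of_fraction' (h : Z * (1 + L * Y) = Y) :
    (1 - Z * L) * (1 + Y * L) = 1 := by
  have h1 : Z * L * (1 + Y * L) = Y * L := by
    nth_rw 2 [← h]
    simp only [Matrix.mul_add, Matrix.add_mul, Matrix.mul_assoc, Matrix.mul_one]
  rw [sub_mul, h1, one_mul, add_sub_cancel_right]

theorem one_add_mul_one_sub_of_fraction' (h : Z * (1 + L * Y) = Y) :
    (1 + Y * L) * (1 - Z * L) = 1 :=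
  mul_eq_one_comm.1 (one_sub_mul_one_add_of_fraction' h)

theorem one_add_mul_of_fraction (h : Z * (1 + L * Y) = Y) : (1 + Y * L) * Z = Y := by
  have h1 : Y * (1 - L * Z) = Z := by
    nth_rw 1 [← h]
    rw [Matrix.mul_assoc, one_add_mul_one_sub_of_fraction h, Matrix.mul_one]
  rw [Matrix.mul_sub, Matrix.mul_one, sub_eq_iff_eq_add, ← Matrix.mul_assoc] at h1
  nth_rw 2 [h1]
  rw [Matrix.add_mul, Matrix.one_mul]

theorem sub_mul_of_fraction (h₁ : Z₁ * (1 + L * Y₁) = Y₁) :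
    Z - (1 - Z * L) * Y₁ = (Z - Z₁) * (1 + L * Y₁) := by
  rw [Matrix.sub_mul Z Z₁, h₁, Matrix.sub_mul, Matrix.mul_add, Matrix.mul_one, Matrix.one_mul,
    Matrix.mul_assoc]
  abel

/-- `Z` differs by a matrix of rank one from the fraction `Y (1 + L Y)⁻¹`. -/
def NearFraction (L : Matrix κ ι E) (Z Y : Matrix ι κ E) : Prop :=
  ∃ Z₁, Z₁ * (1 + L * Y) = Y ∧ ∃ c d, c ≠ 0 ∧ d ≠ 0 ∧ Z - Z₁ = vecMulVec c d

theorem NearFraction.exists_eq (h : NearFraction L Z Y) :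
    ∃ c d, c ≠ 0 ∧ d ≠ 0 ∧ Z - (1 - Z * L) * Y = vecMulVec c d := by
  obtain ⟨Z₁, h₁, c, d, hc, hd, hcd⟩ := h
  refine ⟨c, d ᵥ* (1 + L * Y), hc, fun h0 => hd ?_, ?_⟩
  · have := congrArg (· ᵥ* (1 - L * Z₁)) h0
    simpa only [vecMul_vecMul, one_add_mul_one_sub_of_fraction h₁, vecMul_one, zero_vecMul]
      using this
  · rw [sub_mul_of_fraction h₁, hcd, vecMulVec_mul]

theorem NearFraction.exists_eq_translate {y : ι → E} {x : κ → E}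
    (h : NearFraction L Z (Y + vecMulVec y x)) :
    ∃ c d, c ≠ 0 ∧ d ≠ 0 ∧
      Z - (1 - Z * L) * Y - vecMulVec ((1 - Z * L) *ᵥ y) x = vecMulVec c d := by
  obtain ⟨c, d, hc, hd, h⟩ := h.exists_eq
  exact ⟨c, d, hc, hd, by rw [← h, Matrix.mul_add, mul_vecMulVec, sub_sub]⟩

theorem NearFraction.exists_of_mulVec_eq_zero (h : NearFraction L Z Y) :
    ∃ c : ι → E, ∀ y, (1 - Z * L) *ᵥ y = 0 → ∃ k : E, y = op k • c := by
  obtain ⟨Z₁, h₁, -⟩ := id h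
  obtain ⟨c, d, -, -, h⟩ := h.exists_eq
  have h2 : (1 - Z * L) * (1 + Y * L) + vecMulVec c (d ᵥ* L) = 1 := by
    rw [← vecMulVec_mul, ← h, Matrix.mul_add, Matrix.sub_mul Z, Matrix.mul_assoc, Matrix.mul_one]
    abel
  refine ⟨(1 + Y * L) *ᵥ c, fun y hy => ⟨(d ᵥ* L) ⬝ᵥ ((1 - Z₁ * L) *ᵥ y), ?_⟩⟩
  have hs : (1 + Y * L) *ᵥ ((1 - Z₁ * L) *ᵥ y) = y := by
    rw [mulVec_mulVec, one_add_mul_one_sub_of_fraction' h₁, one_mulVec]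
  generalize (1 - Z₁ * L) *ᵥ y = s at hs ⊢
  have h3 : ((1 - Z * L) * (1 + Y * L) + vecMulVec c (d ᵥ* L)) *ᵥ s = s := by
    rw [h2, one_mulVec]
  rw [add_mulVec, ← mulVec_mulVec, hs, hy, zero_add] at h3
  rw [← hs, ← mulVec_smul]
  congr 1
  refine h3.symm.trans (funext fun i => ?_)
  simp [mulVec, dotProduct, vecMulVec_apply, Finset.mul_sum, mul_assoc]

theorem isUnit_of_nearFraction {y₁ y₂ : ι → E} {x₁ x₂ : κ → E}
    (hy : LinearIndependent Eᵐᵒᵖ ![y₁, y₂]) (hx : LinearIndependent E ![x₁, x₂])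
    (h₁ : NearFraction L Z (Y + vecMulVec y₂ x₂))
    (h₂ : NearFraction L Z (Y + vecMulVec (y₂ - y₁) x₂))
    (h₃ : NearFraction L Z (Y + vecMulVec y₂ (x₂ - x₁)))
    (h₄ : NearFraction L Z (Y + vecMulVec y₁ x₁))
    (h₅ : NearFraction L Z (Y + vecMulVec (y₁ - y₂) x₁))
    (h₆ : NearFraction L Z (Y + vecMulVec y₁ (x₁ - x₂))) : IsUnit (1 - Z * L) := by
  by_contra hB
  have hx1 : x₁ ≠ 0 := by simpa using hx.ne_zero 0
  have hx2 : x₂ ≠ 0 := by simpa using hx.ne_zero 1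
  have hker : ¬ ((1 - Z * L) *ᵥ y₁ = 0 ∧ (1 - Z * L) *ᵥ y₂ = 0) := by
    rintro ⟨h7, h8⟩
    obtain ⟨c, hc⟩ := h₁.exists_of_mulVec_eq_zero
    exact hy.not_pair_smul (exists_op_smul_of_smul (hc _ h7)) (exists_op_smul_of_smul (hc _ h8))
  have him : ∀ {Y : Matrix ι κ E} {c d}, c ≠ 0 → Z - (1 - Z * L) * Y = vecMulVec c d → ∀ y,
      (∃ k : E, (1 - Z * L) *ᵥ y = op k • c) → (1 - Z * L) *ᵥ y = 0 := by
    rintro Y c d - h y ⟨k, hk⟩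
    by_contra hne
    refine hB (isUnit_of_eq_mulVec (t := op k⁻¹ • y) h ?_)
    rw [mulVec_smul]
    exact (eq_op_smul_inv hk hne).2
  have key : ∀ {y₁ y₂ : ι → E} {x₁ x₂ : κ → E}, x₁ ≠ 0 → x₂ ≠ 0 →
      NearFraction L Z (Y + vecMulVec y₂ x₂) →
      NearFraction L Z (Y + vecMulVec (y₂ - y₁) x₂) →
      NearFraction L Z (Y + vecMulVec y₂ (x₂ - x₁)) →
      ∃ c d, Z - (1 - Z * L) * Y - vecMulVec ((1 - Z * L) *ᵥ y₂) x₂ = vecMulVec c d ∧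
        ((1 - Z * L) *ᵥ y₁ = 0 ∨ ∃ k : E, x₂ = k • d) ∧
        ((1 - Z * L) *ᵥ y₂ = 0 ∨ ∃ k : E, x₁ = k • d) := by
    intro y₁ y₂ x₁ x₂ hx1 hx2 h₁ h₂ h₃
    obtain ⟨c, d, hc, hd, h7⟩ := h₁.exists_eq_translate
    obtain ⟨c₂, d₂, -, -, h8⟩ := h₂.exists_eq_translate
    obtain ⟨c₃, d₃, -, -, h9⟩ := h₃.exists_eq_translate
    rw [mulVec_sub] at h8
    obtain ⟨h10, h11⟩ := proportional_of_translates h7 hc hd hx1 hx2 ⟨_, _, h8⟩ ⟨_, _, h9⟩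
    have h12 : Z - (1 - Z * L) * (Y + vecMulVec y₂ x₂) = vecMulVec c d := by
      rw [← h7, Matrix.mul_add, mul_vecMulVec, sub_sub]
    exact ⟨c, d, h7, h10.imp_left (him hc h12 _), h11.imp_left (him hc h12 _)⟩
  obtain ⟨c, d, e₁, p₁, p₂⟩ := key hx1 hx2 h₁ h₂ h₃
  obtain ⟨c', d', e₂, q₂, q₁⟩ := key hx2 hx1 h₄ h₅ h₆
  by_cases h7 : (1 - Z * L) *ᵥ y₁ = 0
  · have h8 : (1 - Z * L) *ᵥ y₂ ≠ 0 := fun h8 => hker ⟨h7, h8⟩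
    rw [h7, zero_vecMulVec, sub_zero] at e₂
    exact hx.not_pair_smul ⟨1, (one_smul _ _).symm⟩ (proportional_of_sub_vecMulVec e₁ e₂ h8 hx1
      (p₂.resolve_left h8) (q₂.resolve_left h8))
  · by_cases h8 : (1 - Z * L) *ᵥ y₂ = 0
    · rw [h8, zero_vecMulVec, sub_zero] at e₁
      exact hx.not_pair_smul (proportional_of_sub_vecMulVec e₂ e₁ h7 hx2
        (q₁.resolve_left h7) (p₁.resolve_left h7)) ⟨1, (one_smul _ _).symm⟩
    · exact hx.not_pair_smul (p₂.resolve_left h8) (p₁.resolve_left h7)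

theorem fraction_or_fraction_of_nearFraction {y₁ y₂ : ι → E} {x₁ x₂ : κ → E}
    (hy : LinearIndependent Eᵐᵒᵖ ![y₁, y₂]) (hx : LinearIndependent E ![x₁, x₂])
    (h₁ : NearFraction L Z (Y + vecMulVec y₂ x₂))
    (h₂ : NearFraction L Z (Y + vecMulVec (y₂ - y₁) x₂))
    (h₃ : NearFraction L Z (Y + vecMulVec y₂ (x₂ - x₁)))
    (h₄ : NearFraction L Z (Y + vecMulVec y₁ x₁))
    (h₅ : NearFraction L Z (Y + vecMulVec (y₁ - y₂) x₁))
    (h₆ : NearFraction L Z (Y + vecMulVec y₁ (x₁ - x₂))) :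
    Z * (1 + L * Y) = Y ∨
      Z * (1 + L * (Y + vecMulVec y₁ x₁ + vecMulVec y₂ x₂)) =
        Y + vecMulVec y₁ x₁ + vecMulVec y₂ x₂ := by
  obtain ⟨B', hB', hB⟩ : ∃ B', B' * (1 - Z * L) = 1 ∧ (1 - Z * L) * B' = 1 := by
    obtain ⟨U, hU⟩ := isUnit_of_nearFraction hy hx h₁ h₂ h₃ h₄ h₅ h₆
    exact ⟨_, hU ▸ U.inv_mul, hU ▸ U.mul_inv⟩
  have htr : ∀ {y x}, NearFraction L Z (Y + vecMulVec y x) →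
      ∃ c d, c ≠ 0 ∧ d ≠ 0 ∧ B' * Z - Y - vecMulVec y x = vecMulVec c d := by
    intro y x h
    obtain ⟨c, d, hc, hd, h7⟩ := h.exists_eq_translate
    refine ⟨B' *ᵥ c, d, fun h0 => hc ?_, hd, ?_⟩
    · have := congrArg ((1 - Z * L) *ᵥ ·) h0
      simpa only [mulVec_mulVec, hB, one_mulVec, mulVec_zero] using this
    · rw [← mul_vecMulVec, ← h7, Matrix.mul_sub, Matrix.mul_sub, ← Matrix.mul_assoc, hB',
        mul_vecMulVec, mulVec_mulVec, hB', one_mulVec, Matrix.one_mul]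
  have hfin : ∀ {Y : Matrix ι κ E}, B' * Z = Y → Z * (1 + L * Y) = Y := by
    intro Y h
    have h8 : Z = (1 - Z * L) * Y := by rw [← h, ← Matrix.mul_assoc, hB, Matrix.one_mul]
    rw [Matrix.sub_mul, Matrix.one_mul, eq_sub_iff_add_eq] at h8
    rw [Matrix.mul_add, Matrix.mul_one, ← Matrix.mul_assoc, h8]
  have hor : ∀ {y₁ y₂ : ι → E} {x₁ x₂ : κ → E}, LinearIndependent Eᵐᵒᵖ ![y₁, y₂] →
      LinearIndependent E ![x₁, x₂] →
      NearFraction L Z (Y + vecMulVec y₂ x₂) →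
      NearFraction L Z (Y + vecMulVec (y₂ - y₁) x₂) →
      NearFraction L Z (Y + vecMulVec y₂ (x₂ - x₁)) →
      (∃ k : E, B' * Z - Y = vecMulVec y₂ x₂ + vecMulVec y₁ (k • x₁)) ∨
        ∃ k : E, B' * Z - Y = vecMulVec y₂ (k • x₂) := by
    intro y₁ y₂ x₁ x₂ hy hx h₁ h₂ h₃
    obtain ⟨c, d, hc, hd, h7⟩ := htr h₁
    obtain ⟨c₂, d₂, -, -, h8⟩ := htr h₂
    obtain ⟨c₃, d₃, -, -, h9⟩ := htr h₃
    exact vecMulVec_eq_of_translates hy hx h7 hc hd ⟨_, _, h8⟩ ⟨_, _, h9⟩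
  rcases eq_zero_or_eq_of_translates hy hx (hor hy hx h₁ h₂ h₃)
    (hor (LinearIndependent.pair_symm_iff.1 hy) (LinearIndependent.pair_symm_iff.1 hx) h₄ h₅ h₆)
    with h | h
  · exact Or.inl (hfin (sub_eq_zero.1 h))
  · exact Or.inr (hfin (by rw [sub_eq_iff_eq_add.1 h]; abel))

end Fraction

section Induction

open MulOpposite

namespace IsTransposing

variable {D E : Type} [DivisionRing D] [DivisionRing E] {m n m' n' : ℕ}
  {θ : Matrix (Fin m) (Fin n) D → Matrix (Fin m') (Fin n') E} (h : IsTransposing θ)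
  {L : Matrix (Fin n') (Fin m') E} {Y : Matrix (Fin m) (Fin n) D →+ Matrix (Fin m') (Fin n') E}
  {y : (Fin n → D) →+ Fin m' → E} {x : (Fin m → D) →+ Fin n' → E}
  (hY : ∀ u v, Y (vecMulVec u v) = vecMulVec (y v) (x u))
  (hy : ∀ v v', LinearIndependent D ![v, v'] → LinearIndependent Eᵐᵒᵖ ![y v, y v'])
  (hx : ∀ u u', LinearIndependent Dᵐᵒᵖ ![u, u'] → LinearIndependent E ![x u, x u'])

include h hY hy hx

theorem eq_or_fraction_add {X : Matrix (Fin m) (Fin n) D}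
    (hX : ∀ u v, θ (X + vecMulVec u v) * (1 + L * Y (X + vecMulVec u v)) = Y (X + vecMulVec u v))
    {u₁ u₂ : Fin m → D} {v₁ v₂ : Fin n → D} (hu : LinearIndependent Dᵐᵒᵖ ![u₁, u₂])
    (hv : LinearIndependent D ![v₁, v₂]) :
    θ (X + vecMulVec u₁ v₁ + vecMulVec u₂ v₂) = θ X ∨
      θ (X + vecMulVec u₁ v₁ + vecMulVec u₂ v₂) *
          (1 + L * Y (X + vecMulVec u₁ v₁ + vecMulVec u₂ v₂)) =
        Y (X + vecMulVec u₁ v₁ + vecMulVec u₂ v₂) := by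
  have hu1 : u₁ ≠ 0 := by simpa using hu.ne_zero 0
  have hu2 : u₂ ≠ 0 := by simpa using hu.ne_zero 1
  have hv1 : v₁ ≠ 0 := by simpa using hv.ne_zero 0
  have hv2 : v₂ ≠ 0 := by simpa using hv.ne_zero 1
  have hu12 : u₁ + u₂ ≠ 0 := fun h0 => by
    have := (LinearIndependent.pair_iff.1 hu) 1 1 (by rw [one_smul, one_smul, h0])
    exact one_ne_zero this.1
  have hv12 : v₁ + v₂ ≠ 0 := fun h0 => by
    have := (LinearIndependent.pair_iff.1 hv) 1 1 (by rw [one_smul, one_smul, h0])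
    exact one_ne_zero this.1
  have hX0 : θ X * (1 + L * Y X) = Y X := by
    simpa only [zero_vecMulVec, add_zero] using hX 0 0
  have near : ∀ u v a b, a ≠ 0 → b ≠ 0 →
      vecMulVec u₁ v₁ + vecMulVec u₂ v₂ = vecMulVec u v + vecMulVec a b →
      NearFraction L (θ (X + vecMulVec u₁ v₁ + vecMulVec u₂ v₂))
        (Y X + vecMulVec (y v) (x u)) := by
    intro u v a b ha hb hab
    obtain ⟨c, d, hc, hd, hcd⟩ := mrank_eq_one_iff.1 (h.adj
      (X + vecMulVec u₁ v₁ + vecMulVec u₂ v₂) (X + vecMulVec u v)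
      (mrank_eq_one_iff.2 ⟨a, b, ha, hb, by rw [add_assoc, hab]; abel⟩))
    rw [← hY, ← map_add]
    exact ⟨_, hX u v, c, d, hc, hd, hcd⟩
  have key := fraction_or_fraction_of_nearFraction (hy _ _ hv) (hx _ _ hu)
    (near u₂ v₂ u₁ v₁ hu1 hv1 (add_comm _ _))
    (map_sub y v₂ v₁ ▸ near u₂ (v₂ - v₁) (u₁ + u₂) v₁ hu12 hv1 (by
      rw [vecMulVec_sub, add_vecMulVec]; abel))
    (map_sub x u₂ u₁ ▸ near (u₂ - u₁) v₂ u₁ (v₁ + v₂) hu1 hv12 (by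
      rw [sub_vecMulVec, vecMulVec_add]; abel))
    (near u₁ v₁ u₂ v₂ hu2 hv2 rfl)
    (map_sub y v₁ v₂ ▸ near u₁ (v₁ - v₂) (u₁ + u₂) v₂ hu12 hv2 (by
      rw [vecMulVec_sub, add_vecMulVec]; abel))
    (map_sub x u₁ u₂ ▸ near (u₁ - u₂) v₁ u₂ (v₁ + v₂) hu2 hv12 (by
      rw [sub_vecMulVec, vecMulVec_add]; abel))
  rcases key with key | key
  · exact Or.inl (fraction_unique key hX0)
  · right
    rwa [map_add, map_add, hY, hY]

theorem fraction_add (hD : (4 : Cardinal) ≤ Cardinal.mk D) {X : Matrix (Fin m) (Fin n) D}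
    (hX : ∀ u v, θ (X + vecMulVec u v) * (1 + L * Y (X + vecMulVec u v)) = Y (X + vecMulVec u v))
    (u₁ u₂ : Fin m → D) (v₁ v₂ : Fin n → D) :
    θ (X + vecMulVec u₁ v₁ + vecMulVec u₂ v₂) *
        (1 + L * Y (X + vecMulVec u₁ v₁ + vecMulVec u₂ v₂)) =
      Y (X + vecMulVec u₁ v₁ + vecMulVec u₂ v₂) := by
  by_cases hu : LinearIndependent Dᵐᵒᵖ ![u₁, u₂]
  swap
  · by_cases hu1 : u₁ = 0
    · rw [hu1, zero_vecMulVec, add_zero]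
      exact hX _ _
    · rw [LinearIndependent.pair_iff' hu1] at hu
      push Not at hu
      obtain ⟨k, rfl⟩ := hu
      rw [← op_unop k, vecMulVec_op_smul, add_assoc, ← vecMulVec_add]
      exact hX _ _
  by_cases hv : LinearIndependent D ![v₁, v₂]
  swap
  · by_cases hv1 : v₁ = 0
    · rw [hv1, vecMulVec_zero_right, add_zero]
      exact hX _ _
    · rw [LinearIndependent.pair_iff' hv1] at hv
      push Not at hv
      obtain ⟨k, rfl⟩ := hv
      rw [← vecMulVec_op_smul, add_assoc, ← add_vecMulVec]
      exact hX _ _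
  have hu1 : u₁ ≠ 0 := by simpa using hu.ne_zero 0
  have hv1 : v₁ ≠ 0 := by simpa using hv.ne_zero 0
  refine (h.eq_or_fraction_add hY hy hx hX hu hv).resolve_left fun heq => ?_
  obtain ⟨t, ht0, ht1, -⟩ := exists_ne_three hD 0 1 1
  have hv' : LinearIndependent D ![t • v₁, v₂] := by
    rw [LinearIndependent.pair_iff] at hv ⊢
    intro a b hab
    rw [smul_smul] at hab
    obtain ⟨h1, h2⟩ := hv _ _ hab
    exact ⟨(mul_eq_zero.1 h1).resolve_right ht0, h2⟩
  obtain ⟨c, d, hc, hd, hcd⟩ := mrank_eq_one_iff.1 (h.adj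
      (X + vecMulVec u₁ (t • v₁) + vecMulVec u₂ v₂) (X + vecMulVec u₁ v₁ + vecMulVec u₂ v₂)
      (mrank_eq_one_iff.2 ⟨u₁, (t - 1) • v₁, hu1, smul_ne_zero (sub_ne_zero.2 ht1) hv1, by
        rw [sub_smul, one_smul, vecMulVec_sub]; abel⟩))
  rw [heq] at hcd
  rcases h.eq_or_fraction_add hY hy hx hX hu hv' with h3 | h3
  · rw [h3, sub_self, eq_comm, vecMulVec_eq_zero_iff] at hcd
    exact hcd.elim hc hd
  · have hX0 : θ X * (1 + L * Y X) = Y X := by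
      simpa only [zero_vecMulVec, add_zero] using hX 0 0
    have h4 := congrArg (fun M => (1 + Y X * L) * M *
      (1 + L * Y (X + vecMulVec u₁ (t • v₁) + vecMulVec u₂ v₂))) hcd
    beta_reduce at h4
    rw [Matrix.mul_sub, one_add_mul_of_fraction hX0, Matrix.sub_mul, Matrix.mul_assoc, h3,
      mul_vecMulVec, vecMulVec_mul] at h4
    refine vecMulVec_add_vecMulVec_ne (hy _ _ hv') (hx _ _ hu) (Eq.trans ?_ h4)
    rw [Matrix.mul_add (Y X), Matrix.mul_one, Matrix.add_mul, Matrix.one_mul, Matrix.mul_assoc,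
      map_add, map_add, hY, hY]
    abel

theorem fraction_of_forall_vecMulVec (hD : (4 : Cardinal) ≤ Cardinal.mk D)
    (h1 : ∀ u v, θ (vecMulVec u v) * (1 + L * Y (vecMulVec u v)) = Y (vecMulVec u v))
    (X : Matrix (Fin m) (Fin n) D) : θ X * (1 + L * Y X) = Y X := by
  have key : ∀ s : Finset (Fin m), ∀ u v,
      θ ((∑ i ∈ s, vecMulVec (Pi.single i 1) (X i)) + vecMulVec u v) *
        (1 + L * Y ((∑ i ∈ s, vecMulVec (Pi.single i 1) (X i)) + vecMulVec u v)) =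
          Y ((∑ i ∈ s, vecMulVec (Pi.single i 1) (X i)) + vecMulVec u v) := by
    intro s
    induction s using Finset.induction_on with
    | empty => simpa only [Finset.sum_empty, zero_add] using h1
    | insert i s hi ih =>
      intro u v
      rw [Finset.sum_insert hi, add_comm (vecMulVec _ _)]
      exact h.fraction_add hY hy hx hD ih _ _ _ _
  have h2 : ∑ i, vecMulVec (Pi.single i 1) (X i) = X := by
    ext i j
    simp [Matrix.sum_apply, vecMulVec_apply, Pi.single_apply]
  simpa only [h2, zero_vecMulVec, add_zero] using key Finset.univ 0 0

end IsTransposing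

end Induction

section Coordinates

open MulOpposite

theorem LinearIndependent.pair_of_ne {ι R M : Type*} [Semiring R] [AddCommMonoid M] [Module R M]
    {v : ι → M} (h : LinearIndependent R v) {i j : ι} (hij : i ≠ j) :
    LinearIndependent R ![v i, v j] := by
  have := h.comp ![i, j] (by
    intro a b hab
    fin_cases a <;> fin_cases b <;> simp_all)
  convert this using 1
  ext a
  fin_cases a <;> rfl

theorem linearIndependent_op_single_one (ι R : Type*) [Finite ι] [DecidableEq ι] [Semiring R] :
    LinearIndependent Rᵐᵒᵖ fun i : ι => (Pi.single i 1 : ι → R) := by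
  have := Fintype.ofFinite ι
  rw [Fintype.linearIndependent_iffₛ]
  intro f g hfg i
  have := congrFun hfg i
  simpa [Finset.sum_apply, Pi.single_apply] using this

/-- A ring homomorphism preserves the linear independence of pairs of coordinate vectors. -/
theorem LinearIndependent.pair_map_sum_smul {ι R S V : Type*} [Fintype ι] [DivisionRing R]
    [DivisionRing S] [AddCommGroup V] [Module S V] (τ : R →+* S) {G : ι → V}
    (hG : LinearIndependent S G) {a b : ι → R} (h : LinearIndependent R ![a, b]) :
    LinearIndependent S ![∑ j, τ (a j) • G j, ∑ j, τ (b j) • G j] := by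
  have hτ : ∀ {r}, τ r = 0 → r = 0 := fun hr => (map_eq_zero τ).1 hr
  rw [LinearIndependent.pair_iff]
  intro k l hkl
  simp only [Finset.smul_sum, smul_smul, ← Finset.sum_add_distrib, ← add_smul] at hkl
  have h1 := Fintype.linearIndependent_iff.1 hG _ hkl
  obtain ⟨i, hi⟩ := Function.ne_iff.1 (show a ≠ 0 by simpa using h.ne_zero 0)
  have hb : ∃ j, b j - b i * (a i)⁻¹ * a j ≠ 0 := by
    by_contra! hb
    have := LinearIndependent.pair_iff.1 h (-(b i * (a i)⁻¹)) 1 (by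
      ext j
      simpa [sub_eq_neg_add] using hb j)
    exact one_ne_zero this.2
  obtain ⟨j, hj⟩ := hb
  have hk : k = -(l * τ (b i * (a i)⁻¹)) := by
    rw [map_mul, map_inv₀, ← mul_assoc, eq_neg_iff_add_eq_zero,
      ← mul_eq_zero_iff_right (b := τ (a i)) (fun h0 => hi (hτ h0)), add_mul,
      inv_mul_cancel_right₀ (fun h0 => hi (hτ h0))]
    exact h1 i
  have hl : l = 0 := by
    have h2 := h1 j
    rw [hk, neg_mul, mul_assoc, ← map_mul, neg_add_eq_sub, ← mul_sub, ← map_sub] at h2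
    exact (mul_eq_zero.1 h2).resolve_right fun h0 => hj (hτ h0)
  exact ⟨by rw [hk, hl, zero_mul, neg_zero], hl⟩

theorem exists_antihom_of_family {D E I J : Type*} [DivisionRing D] [DivisionRing E] [Nonempty I]
    [Nontrivial J] {S : I → J → D →+ E} {κ : J → J → D → E} {μ : I → I → D → E}
    (hκ : ∀ i j k x b, j ≠ k → x ≠ 0 → S i k b * κ j k x = S i j (x * b))
    (hμ : ∀ j i k x b, i ≠ k → x ≠ 0 → μ i k x * S k j b = S i j (b * x))
    (hS : ∀ i j b, b ≠ 0 → S i j b ≠ 0) :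
    ∃ (σ : D →+ E) (p : I → E) (q : J → E), σ 1 = 1 ∧ (∀ a b, σ (a * b) = σ b * σ a) ∧
      (∀ i, p i ≠ 0) ∧ (∀ j, q j ≠ 0) ∧ ∀ i j b, S i j b = p i * σ b * q j := by
  obtain ⟨i₀⟩ := ‹Nonempty I›
  obtain ⟨j₀, j₁, hj⟩ := exists_pair_ne J
  have hp : ∀ i, ∃ p, ∀ j b, S i j b = p * S i₀ j b := by
    intro i
    by_cases hi : i = i₀
    · exact ⟨1, by simp [hi]⟩
    · exact ⟨μ i i₀ 1, fun j b => by rw [hμ j i i₀ 1 b hi one_ne_zero, mul_one]⟩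
  have hq : ∀ j, ∃ q, ∀ i b, S i j b = S i j₀ b * q := by
    intro j
    by_cases hj : j = j₀
    · exact ⟨1, by simp [hj]⟩
    · exact ⟨κ j j₀ 1, fun i b => by rw [hκ i j j₀ 1 b hj one_ne_zero, one_mul]⟩
  choose p hp using hp
  choose q hq using hq
  have h0 : S i₀ j₀ 1 ≠ 0 := hS _ _ _ one_ne_zero
  refine ⟨(AddMonoidHom.mulRight (S i₀ j₀ 1)⁻¹).comp (S i₀ j₀), p, fun j => S i₀ j₀ 1 * q j,
    ?_, ?_, ?_, ?_, ?_⟩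
  · simp [mul_inv_cancel₀ h0]
  · intro a b
    by_cases ha : a = 0
    · simp [ha]
    have h1 : ∀ b, S i₀ j₀ b * (q j₁ * κ j₀ j₁ a) = S i₀ j₀ (a * b) := fun b => by
      rw [← mul_assoc, ← hq, hκ _ _ _ _ _ hj ha]
    have h2 : q j₁ * κ j₀ j₁ a = (S i₀ j₀ 1)⁻¹ * S i₀ j₀ a := by
      rw [eq_inv_mul_iff_mul_eq₀ h0, h1, mul_one]
    simp [← h1, h2, mul_assoc]
  · intro i hi
    exact hS i j₀ 1 one_ne_zero (by rw [hp, hi, zero_mul])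
  · intro j hj
    exact hS i₀ j 1 one_ne_zero ((hq _ _ _).trans hj)
  · intro i j b
    simp [hp i, hq j, mul_assoc, h0]

end Coordinates

section NormalForm

open MulOpposite

theorem Cardinal.le_mk_mulOpposite {D : Type} {c : Cardinal} (hD : c ≤ Cardinal.mk D) :
    c ≤ Cardinal.mk Dᵐᵒᵖ :=
  hD.trans_eq (Cardinal.mk_congr opEquiv)

namespace IsTransposing

variable {D E : Type} [DivisionRing D] [DivisionRing E] {m n m' n' : ℕ}
  {θ : Matrix (Fin m) (Fin n) D → Matrix (Fin m') (Fin n') E} (h : IsTransposing θ)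
  {e : Fin m → Fin n' → E} {f : Fin n → Fin m' → E} {k : Fin m → (Fin n → D) → Fin m' → E}
  {l : Fin n → (Fin m → D) → Fin n' → E}
  (hk : ∀ i v, θ (vecMulVec (Pi.single i 1) v) = vecMulVec (k i v) (e i))
  (hl : ∀ j u, θ (vecMulVec u (Pi.single j 1)) = vecMulVec (f j) (l j u))

include hk hl in
theorem exists_coordinates (he : ∀ i, e i ≠ 0) (hf : ∀ j, f j ≠ 0) :
    ∃ φ : Fin m → Fin n → D → E, (∀ i j t, k i (t • Pi.single j 1) = op (φ i j t) • f j) ∧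
      ∀ i j t, l j (op t • Pi.single i 1) = φ i j t • e i := by
  have key : ∀ (i : Fin m) (j : Fin n) (t : D), ∃ a : E, k i (t • Pi.single j 1) = op a • f j ∧
      l j (op t • Pi.single i 1) = a • e i := by
    intro i j t
    have h1 := hk i (t • (Pi.single j 1 : Fin n → D))
    rw [← vecMulVec_op_smul, hl] at h1
    obtain ⟨a, ha⟩ := eq_op_smul_of_vecMulVec_eq h1.symm (he i)
    refine ⟨a, ha, ?_⟩
    rw [ha, vecMulVec_op_smul] at h1
    obtain ⟨b, hb⟩ := eq_smul_of_vecMulVec_eq h1 (hf j)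
    rw [← sub_eq_zero, ← vecMulVec_sub, vecMulVec_eq_zero_iff] at h1
    exact sub_eq_zero.1 (h1.resolve_left (hf j))
  choose φ hφ hφ' using key
  exact ⟨φ, hφ, hφ'⟩

include h hk hl in
theorem exists_normal_form (hD : (4 : Cardinal) ≤ Cardinal.mk D) (hm : 2 ≤ m) (hn : 2 ≤ n)
    (he : LinearIndependent E e) (hf : LinearIndependent Eᵐᵒᵖ f) :
    ∃ (σ : D →+ E) (p : Fin m → E) (q : Fin n → E) (L : Fin m → Fin n → E)
      (φ : Fin m → Fin n → D → E),
      σ 1 = 1 ∧ (∀ a b, σ (a * b) = σ b * σ a) ∧ (∀ i, p i ≠ 0) ∧ (∀ j, q j ≠ 0) ∧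
      (∀ i j t, k i (t • Pi.single j 1) = op (φ i j t) • f j) ∧
      (∀ i j t, l j (op t • Pi.single i 1) = φ i j t • e i) ∧
      ∀ i j t, (1 + σ t * L i j) * ((q j)⁻¹ * φ i j t) = σ t * p i := by
  have : Nontrivial (Fin m) := Fin.nontrivial_iff_two_le.2 hm
  have : Nontrivial (Fin n) := Fin.nontrivial_iff_two_le.2 hn
  obtain ⟨φ, hφ, hφ'⟩ := exists_coordinates hk hl he.ne_zero hf.ne_zero
  have hgk : ∀ i, IsLineation D Eᵐᵒᵖ (k i) := fun i =>
    h.isLineation_row (by simp) (he.ne_zero i) (hk i)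
  have hgl : ∀ j, IsLineation Dᵐᵒᵖ E (l j) := fun j =>
    h.isLineation_col (by simp) (hf.ne_zero j) (hl j)
  have hwn := Pi.linearIndependent_single_one (Fin n) D
  have hwm := linearIndependent_op_single_one (Fin m) D
  obtain ⟨s, c, κ, hs, hκ, hs0⟩ := IsLineation.exists_additive_family hD hgk
    (w := fun j => Pi.single j 1) (e := f) (φ := fun i j t => op (φ i j t))
    (fun i j hij => hwn.pair_of_ne hij) (fun i j hij => hf.pair_of_ne hij) hφ (by
      intro i j hij x hx
      have hne : (Pi.single i 1 + x • Pi.single j 1 : Fin n → D) ≠ 0 := fun h0 =>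
        one_ne_zero (LinearIndependent.pair_iff.1 (hwn.pair_of_ne hij) 1 x
          (by rw [one_smul]; exact h0)).1
      obtain ⟨d, hd, hr⟩ := h.exists_col hne
      refine ⟨d, fun i₁ a => ?_⟩
      obtain ⟨r, hr⟩ := hr (op a • (Pi.single i₁ 1 : Fin m → D))
      rw [vecMulVec_op_smul, hk] at hr
      exact exists_op_smul_of_smul (eq_op_smul_of_vecMulVec_eq hr (he.ne_zero i₁)))
  obtain ⟨s', c', μ, hs', hμ, -⟩ := IsLineation.exists_additive_family
    (Cardinal.le_mk_mulOpposite hD) hgl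
    (w := fun j => Pi.single j 1) (e := e) (φ := fun j i t => φ i j (unop t))
    (fun i j hij => hwm.pair_of_ne hij) (fun i j hij => he.pair_of_ne hij)
    (fun j i a => hφ' i j (unop a)) (by
      intro i j hij x hx
      have hne : (Pi.single i 1 : Fin m → D) + x • (Pi.single j 1 : Fin m → D) ≠ 0 := fun h0 =>
        one_ne_zero (LinearIndependent.pair_iff.1 (hwm.pair_of_ne hij) 1 x
          (by rw [one_smul]; exact h0)).1
      obtain ⟨r, hr, hd⟩ := h.exists_row hne
      refine ⟨r, fun j₁ a => ?_⟩
      obtain ⟨d, hd⟩ := hd (unop a • (Pi.single j₁ 1 : Fin n → D))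
      rw [← vecMulVec_op_smul, op_unop, hl] at hd
      exact eq_smul_of_vecMulVec_eq hd (hf.ne_zero j₁))
  let S : Fin m → Fin n → D →+ E := fun i j => opAddEquiv.symm.toAddMonoidHom.comp (s i j)
  have hS : ∀ i j b, S i j b = unop (s i j b) := fun _ _ _ => rfl
  have hSc : ∀ i j a, a ≠ 0 → (φ i j a⁻¹)⁻¹ = S i j a + unop (c i j) := fun i j a ha => by
    rw [hS, ← unop_add, ← hs i j a ha, unop_inv, unop_op]
  have hSS : ∀ i j, S i j = (s' j i).comp opAddEquiv.toAddMonoidHom := by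
    intro i j
    refine (AddMonoidHom.eq_of_add_const_eq hD (c := unop (c i j)) (c' := c' j i)
      fun a ha => ?_).1
    rw [← hSc i j a ha]
    simpa using hs' j i (op a) ((op_ne_zero_iff a).2 ha)
  have hSS' : ∀ i j b, S i j b = s' j i (op b) := fun i j b => by rw [hSS]; rfl
  obtain ⟨σ, p, q, h1, hmul, hp, hq, hpq⟩ := exists_antihom_of_family (S := S)
    (κ := fun j j₁ x => unop (κ j j₁ x)) (μ := fun i i₁ x => μ i i₁ (op x))
    (fun i j j₁ x b hj hx => by rw [hS, hS, ← hκ i j j₁ x b hj hx, unop_mul])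
    (fun j i i₁ x b hi hx => by
      rw [hSS', hSS', hμ j i i₁ (op x) (op b) hi ((op_ne_zero_iff x).2 hx), op_mul])
    (fun i j b hb h0 => hs0 i j b hb (unop_eq_zero_iff _ |>.1 h0))
  refine ⟨σ, fun i => (p i)⁻¹, fun j => (q j)⁻¹,
    fun i j => (p i)⁻¹ * unop (c i j) * (q j)⁻¹, φ, h1, hmul, fun i => inv_ne_zero (hp i),
    fun j => inv_ne_zero (hq j), hφ, hφ', ?_⟩
  intro i j t
  by_cases ht : t = 0
  · have : φ i j 0 = 0 := by
      have h2 := hφ' i j 0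
      have h5 : l j 0 = 0 := (hgl j).map_zero
      rw [op_zero, zero_smul, h5, eq_comm, smul_eq_zero] at h2
      exact h2.resolve_right (he.ne_zero i)
    rw [ht, this, _root_.map_zero]
    simp
  have hφ0 : φ i j t ≠ 0 := (hgl j).coord_ne_zero (φ := fun t => φ i j (unop t))
    (fun a => hφ' i j (unop a)) (by simp) ((op_ne_zero_iff t).2 ht)
  have h2 := hSc i j t⁻¹ (inv_ne_zero ht)
  rw [inv_inv, hpq] at h2
  have h3 : σ t * σ t⁻¹ = 1 := by rw [← hmul, inv_mul_cancel₀ ht, h1]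
  have h4 : (1 + σ t * ((p i)⁻¹ * unop (c i j) * (q j)⁻¹)) * q j =
      σ t * (p i)⁻¹ * (φ i j t)⁻¹ := by
    simp only [h2, mul_add, add_mul, one_mul, ← mul_assoc]
    rw [inv_mul_cancel_right₀ (hq j), inv_mul_cancel_right₀ (hp i), h3, one_mul]
  rw [inv_inv, ← mul_assoc, h4, inv_mul_cancel_right₀ hφ0]

end IsTransposing

end NormalForm

section RankOne

open MulOpposite

theorem exists_ringHom_of_antihom {D E : Type*} [DivisionRing D] [DivisionRing E]
    {σ : D →+ E} (h1 : σ 1 = 1) (hmul : ∀ a b, σ (a * b) = σ b * σ a) :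
    (∃ τ : D →+* Eᵐᵒᵖ, ∀ a, τ a = op (σ a)) ∧ ∃ τ : Dᵐᵒᵖ →+* E, ∀ a, τ a = σ (unop a) :=
  ⟨⟨{ toFun := fun a => op (σ a)
      map_one' := by rw [h1, op_one]
      map_mul' := fun a b => by rw [hmul, op_mul]
      map_zero' := by rw [map_zero, op_zero]
      map_add' := fun a b => by rw [map_add, op_add] }, fun _ => rfl⟩,
    ⟨{ toFun := fun a => σ (unop a)
       map_one' := by rw [unop_one, h1]
       map_mul' := fun a b => by rw [unop_mul, hmul]
       map_zero' := by rw [unop_zero, map_zero]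
       map_add' := fun a b => by rw [unop_add, map_add] }, fun _ => rfl⟩⟩

namespace IsTransposing

variable {D E : Type} [DivisionRing D] [DivisionRing E] {m n m' n' : ℕ}
  {θ : Matrix (Fin m) (Fin n) D → Matrix (Fin m') (Fin n') E} (h : IsTransposing θ)
  (hD : (4 : Cardinal) ≤ Cardinal.mk D)
  {e : Fin m → Fin n' → E} {f : Fin n → Fin m' → E} {l : Fin n → (Fin m → D) → Fin n' → E}
  (hl : ∀ j u, θ (vecMulVec u (Pi.single j 1)) = vecMulVec (f j) (l j u))
  (he : LinearIndependent E e) (hf : LinearIndependent Eᵐᵒᵖ f) {σ : D →+ E} (hσ1 : σ 1 = 1)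
  (hσ : ∀ a b, σ (a * b) = σ b * σ a) {L : Fin m → Fin n → E}
  (hL : ∀ i j t, (1 + σ t * L i j) • l j (op t • Pi.single i 1) = σ t • e i)

include h hD hl he hf hσ1 hσ hL

theorem one_add_sum_smul_col (j : Fin n) (u : Fin m → D) :
    1 + ∑ i, σ (u i) * L i j ≠ 0 ∧ (1 + ∑ i, σ (u i) * L i j) • l j u = ∑ i, σ (u i) • e i := by
  obtain ⟨-, τ, hτ⟩ := exists_ringHom_of_antihom hσ1 hσ
  have h1 := (h.isLineation_col (by simp) (hf.ne_zero j) (hl j)).one_add_sum_smul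
    (Cardinal.le_mk_mulOpposite hD) (w := fun i => Pi.single i 1) he (σ := τ)
    (l := fun i => L i j) (fun i t => by rw [hτ]; exact hL i j (unop t)) Finset.univ
    (fun i => op (u i))
  have h2 : ∑ i, op (u i) • (Pi.single i 1 : Fin m → D) = u := by
    ext i
    simp [Finset.sum_apply, Pi.single_apply]
  simpa only [hτ, unop_op, h2] using h1

theorem exists_row_eq_vecMulVec (hn : 0 < n) {u : Fin m → D} (hu : u ≠ 0) :
    ∑ i, σ (u i) • e i ≠ 0 ∧
      ∃ k : (Fin n → D) → Fin m' → E, ∀ v, θ (vecMulVec u v) = vecMulVec (k v) (∑ i, σ (u i) • e i) := by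
  have h1 := h.one_add_sum_smul_col hD hl he hf hσ1 hσ hL ⟨0, hn⟩ u
  have h2 : l ⟨0, hn⟩ u ≠ 0 :=
    (h.isLineation_col (by simp) (hf.ne_zero ⟨0, hn⟩) (hl ⟨0, hn⟩)).ne_zero hu
  have h3 : ∑ i, σ (u i) • e i ≠ 0 := h1.2 ▸ smul_ne_zero h1.1 h2
  refine ⟨h3, ?_⟩
  obtain ⟨r, hr, hk⟩ := h.exists_row hu
  choose k hk using hk
  have h4 := (hl ⟨0, hn⟩ u).symm.trans (hk _)
  obtain ⟨a, ha⟩ := eq_smul_of_vecMulVec_eq h4 (hf.ne_zero _)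
  rw [ha, smul_smul] at h1
  obtain ⟨-, hb⟩ := eq_smul_inv h1.2.symm h3
  refine ⟨fun v => op (((1 + ∑ i, σ (u i) * L i ⟨0, hn⟩) * a)⁻¹) • k v, fun v => ?_⟩
  rw [hk, vecMulVec_op_smul, ← hb]

theorem exists_eq_vecMulVec (hn : 0 < n) (u : Fin m → D) (v : Fin n → D) :
    ∃ k, θ (vecMulVec u v) = vecMulVec k (∑ i, σ (u i) • e i) ∧
      op (1 + ∑ j, (∑ i, σ (u i) * L i j) * σ (v j)) • k = ∑ j, op (σ (v j)) • f j := by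
  by_cases hu : u = 0
  · exact ⟨∑ j, op (σ (v j)) • f j, by simp [hu, h.map_zero, vecMulVec_zero_right], by simp [hu]⟩
  obtain ⟨hne, k, hk⟩ := h.exists_row_eq_vecMulVec hD hl he hf hσ1 hσ hL hn hu
  obtain ⟨⟨τ, hτ⟩, -⟩ := exists_ringHom_of_antihom hσ1 hσ
  refine ⟨k v, hk v, ?_⟩
  have h1 := (h.isLineation_row hu hne hk).one_add_sum_smul hD (w := fun j => Pi.single j 1)
    hf (σ := τ) (l := fun j => op (∑ i, σ (u i) * L i j)) (fun j t => by
      set lam := ∑ i, σ (u i) * L i j with hlam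
      have h2 : ∑ i, σ ((op t • u) i) * L i j = σ t * lam := by
        simp [hlam, Finset.mul_sum, hσ, mul_assoc]
      have h3 : ∑ i, σ ((op t • u) i) • e i = σ t • ∑ i, σ (u i) • e i := by
        simp [Finset.smul_sum, hσ, mul_smul]
      obtain ⟨h4, h5⟩ := h.one_add_sum_smul_col hD hl he hf hσ1 hσ hL j (op t • u)
      rw [h2] at h4
      rw [h2, h3] at h5
      have h6 := hk (t • Pi.single j 1)
      rw [← vecMulVec_op_smul, hl, (eq_inv_smul_iff₀ h4).2 h5, smul_smul, ← vecMulVec_op_smul,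
        ← sub_eq_zero, ← sub_vecMulVec, vecMulVec_eq_zero_iff] at h6
      rw [hτ, ← sub_eq_zero.1 (h6.resolve_right hne), smul_smul, ← op_mul, ← op_one, ← op_add,
        ← op_mul]
      congr 2
      rw [mul_assoc, mul_add, mul_one, ← mul_assoc (σ t), ← one_add_mul, inv_mul_cancel_left₀ h4])
    Finset.univ v
  have h7 : ∑ j, v j • (Pi.single j 1 : Fin n → D) = v := by
    ext i
    simp [Finset.sum_apply, Pi.single_apply]
  rw [h7] at h1
  simpa only [hτ, op_add, op_one, Finset.op_sum, op_mul] using h1.2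

end IsTransposing

end RankOne

section Assembly

open MulOpposite

theorem eq_mul_inverse_of_fraction {E ι κ a b : Type*} [DivisionRing E] [Fintype ι] [Fintype κ]
    [Fintype a] [Fintype b] [DecidableEq κ] [DecidableEq a] [DecidableEq b] {F : Matrix ι b E}
    {F' : Matrix b ι E} {G : Matrix a κ E} {G' : Matrix κ a E} (hF : F' * F = 1) (hG : G * G' = 1)
    {L : Matrix a b E} {M : Matrix b a E} {Z : Matrix ι κ E}
    (h : Z * (1 + G' * L * F' * (F * M * G)) = F * M * G) :
    IsUnit (1 + L * M) ∧ Z = F * (M * Ring.inverse (1 + L * M)) * G := by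
  have e1 : G' * L * F' * (F * M * G) = G' * (L * M) * G := by
    calc G' * L * F' * (F * M * G) = G' * L * (F' * F) * (M * G) := by
          simp only [Matrix.mul_assoc]
      _ = _ := by rw [hF, Matrix.mul_one]; simp only [Matrix.mul_assoc]
  have e2 : G * (1 + G' * (L * M) * G) = (1 + L * M) * G := by
    rw [Matrix.mul_add, ← Matrix.mul_assoc, ← Matrix.mul_assoc, hG, Matrix.one_mul,
      Matrix.mul_one, Matrix.add_mul, Matrix.one_mul]
  have hV := one_add_mul_one_sub_of_fraction h
  have hV' : IsUnit (1 + L * M) := by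
    refine IsUnit.of_mul_eq_one (G * (1 - G' * L * F' * Z) * G') ?_
    rw [← Matrix.mul_assoc, ← Matrix.mul_assoc, ← e2, Matrix.mul_assoc G, ← e1, hV, Matrix.mul_one,
      hG]
  refine ⟨hV', fraction_unique h ?_⟩
  rw [e1, Matrix.mul_assoc, e2, ← Matrix.mul_assoc, Matrix.mul_assoc F, Matrix.mul_assoc M,
    Ring.inverse_mul_cancel _ hV', Matrix.mul_one]

theorem eq_zero_of_forall_isUnit_one_add_mul {D E : Type*} [DivisionRing D] [DivisionRing E]
    {a b : Type*} [Fintype a] [Fintype b] [DecidableEq a] [DecidableEq b] {σ : D →+ E}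
    (hσ : Function.Surjective σ) {L : Matrix a b E}
    (h : ∀ X : Matrix a b D, IsUnit (1 + L * (X.map σ)ᵀ)) : L = 0 := by
  ext i j
  by_contra hij
  rw [Matrix.zero_apply] at hij
  obtain ⟨d, hd⟩ := hσ (-(L i j)⁻¹)
  obtain ⟨U, hU⟩ := h (Matrix.single i j d)
  have h1 : Pi.single i 1 ᵥ* (U : Matrix a a E) = 0 := by
    rw [hU, vecMul_add, vecMul_one, ← vecMul_vecMul, Matrix.single_one_vecMul]
    ext k
    simp only [Pi.add_apply, vecMul, dotProduct, transpose_apply, map_apply, Matrix.single_apply,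
      Pi.zero_apply]
    rw [Finset.sum_eq_single j (by
      intro j' _ hj'
      rw [if_neg fun h => hj' h.2.symm, map_zero, mul_zero]) (by simp)]
    by_cases hk : i = k
    · subst hk
      simp [hd, hij]
    · simp [hk, Ne.symm hk]
  have h2 := congrArg (· ᵥ* ((U⁻¹ : (Matrix a a E)ˣ) : Matrix a a E)) h1
  simp only [vecMul_vecMul, Units.mul_inv, vecMul_one, zero_vecMul] at h2
  simpa using congrFun h2 i

namespace IsTransposing

variable {D E : Type} [DivisionRing D] [DivisionRing E] {m n m' n' : ℕ}
  {θ : Matrix (Fin m) (Fin n) D → Matrix (Fin m') (Fin n') E} (h : IsTransposing θ)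
  (hD : (4 : Cardinal) ≤ Cardinal.mk D)
  {e : Fin m → Fin n' → E} {f : Fin n → Fin m' → E} {l : Fin n → (Fin m → D) → Fin n' → E}
  (hl : ∀ j u, θ (vecMulVec u (Pi.single j 1)) = vecMulVec (f j) (l j u))
  (he : LinearIndependent E e) (hf : LinearIndependent Eᵐᵒᵖ f) {σ : D →+ E} (hσ1 : σ 1 = 1)
  (hσ : ∀ a b, σ (a * b) = σ b * σ a) {L : Matrix (Fin m) (Fin n) E}
  (hL : ∀ i j t, (1 + σ t * L i j) • l j (op t • Pi.single i 1) = σ t • e i)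

include h hD hl he hf hσ1 hσ hL

theorem fraction_of_normal_form (hn : 0 < n) {F' : Matrix (Fin n) (Fin m') E}
    {G' : Matrix (Fin n') (Fin m) E} (hF : F' * (Matrix.of f)ᵀ = 1) (hG : Matrix.of e * G' = 1)
    (X : Matrix (Fin m) (Fin n) D) :
    θ X * (1 + G' * L * F' * ((Matrix.of f)ᵀ * (X.map σ)ᵀ * Matrix.of e)) =
      (Matrix.of f)ᵀ * (X.map σ)ᵀ * Matrix.of e := by
  obtain ⟨⟨τ, hτ⟩, τ', hτ'⟩ := exists_ringHom_of_antihom hσ1 hσ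
  let Y : Matrix (Fin m) (Fin n) D →+ Matrix (Fin m') (Fin n') E :=
    { toFun := fun X => (Matrix.of f)ᵀ * (X.map σ)ᵀ * Matrix.of e
      map_zero' := by simp
      map_add' := fun X X' => by
        rw [Matrix.map_add σ (map_add σ), transpose_add, Matrix.mul_add, Matrix.add_mul] }
  let y : (Fin n → D) →+ Fin m' → E :=
    { toFun := fun v => (Matrix.of f)ᵀ *ᵥ (fun j => σ (v j))
      map_zero' := by
        simp only [Pi.zero_apply, _root_.map_zero]
        exact mulVec_zero _
      map_add' := fun v v' => by
        simp only [Pi.add_apply, map_add]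
        exact mulVec_add _ _ _ }
  let x : (Fin m → D) →+ Fin n' → E :=
    { toFun := fun u => (fun i => σ (u i)) ᵥ* Matrix.of e
      map_zero' := by
        simp only [Pi.zero_apply, _root_.map_zero]
        exact zero_vecMul _
      map_add' := fun u u' => by
        simp only [Pi.add_apply, map_add]
        exact add_vecMul _ _ _ }
  have hYdef : ∀ X, Y X = (Matrix.of f)ᵀ * (X.map σ)ᵀ * Matrix.of e := fun _ => rfl
  have hydef : ∀ v, y v = (Matrix.of f)ᵀ *ᵥ (fun j => σ (v j)) := fun _ => rfl
  have hxdef : ∀ u, x u = (fun i => σ (u i)) ᵥ* Matrix.of e := fun _ => rfl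
  have hysum : ∀ v, y v = ∑ j, op (σ (v j)) • f j := fun v => by
    rw [hydef, mulVec_eq_sum]
    rfl
  have hxsum : ∀ u, x u = ∑ i, σ (u i) • e i := fun u => by
    rw [hxdef, vecMul_eq_sum]
    rfl
  have hY : ∀ u v, Y (vecMulVec u v) = vecMulVec (y v) (x u) := by
    intro u v
    have h1 : ((vecMulVec u v).map σ)ᵀ = vecMulVec (fun j => σ (v j)) (fun i => σ (u i)) := by
      ext j i
      simp [vecMulVec_apply, hσ]
    rw [hYdef, h1, mul_vecMulVec, vecMulVec_mul, hydef, hxdef]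
  refine h.fraction_of_forall_vecMulVec (Y := Y) (y := y) (x := x) (L := G' * L * F') hY ?_ ?_ hD
    ?_ X
  · intro v v' hv
    rw [hysum, hysum]
    simpa only [hτ] using LinearIndependent.pair_map_sum_smul τ hf hv
  · intro u u' hu
    have h1 : LinearIndependent Dᵐᵒᵖ ![fun i => op (u i), fun i => op (u' i)] := by
      rw [LinearIndependent.pair_iff] at hu ⊢
      intro a b hab
      refine hu a b (funext fun i => ?_)
      simpa [← op_mul, ← op_add] using congrArg unop (congrFun hab i)
    rw [hxsum, hxsum]
    simpa only [hτ', unop_op] using LinearIndependent.pair_map_sum_smul τ' he h1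
  · intro u v
    obtain ⟨k, h1, h2⟩ := h.exists_eq_vecMulVec hD hl he hf hσ1 hσ hL hn u v
    rw [← hxsum] at h1
    rw [← hysum] at h2
    have h3 : x u ᵥ* (G' * L * F') ⬝ᵥ y v = ∑ j, (∑ i, σ (u i) * L i j) * σ (v j) := by
      rw [hxdef, hydef, ← vecMul_vecMul, ← vecMul_vecMul, vecMul_vecMul _ _ G', hG, vecMul_one,
        dotProduct_mulVec, vecMul_vecMul, hF, vecMul_one]
      rfl
    rw [h1, hY, Matrix.mul_add, Matrix.mul_one, mul_vecMulVec, vecMulVec_mul_vecMulVec,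
      dotProduct_mulVec, ← vecMulVec_add, h3, ← h2, vecMulVec_op_smul, add_smul, one_smul]

end IsTransposing

end Assembly

section Blocks

open MulOpposite

variable {E : Type} [DivisionRing E] {a b a' b' : ℕ}

theorem linearIndependent_single_castLE (ha : a ≤ a') {p : Fin a → E} (hp : ∀ i, p i ≠ 0) :
    LinearIndependent E fun i => (Pi.single (Fin.castLE ha i) (p i) : Fin a' → E) := by
  convert ((Pi.linearIndependent_single_one (Fin a') E).comp _
    (Fin.castLE_injective ha)).units_smul fun i => Units.mk0 (p i) (hp i) using 1
  ext i j
  simp [Units.smul_def, Pi.single_apply]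

theorem linearIndependent_op_single_castLE (ha : a ≤ a') {p : Fin a → E} (hp : ∀ i, p i ≠ 0) :
    LinearIndependent Eᵐᵒᵖ fun i => (Pi.single (Fin.castLE ha i) (p i) : Fin a' → E) := by
  convert ((linearIndependent_op_single_one (Fin a') E).comp _
    (Fin.castLE_injective ha)).units_smul fun i => Units.mk0 (op (p i)) (by simpa using hp i) using 1
  ext i j
  simp [Units.smul_def, Pi.single_apply]

theorem of_single_castLE_mul_transpose (ha : a ≤ a') {p q : Fin a → E}
    (hpq : ∀ i, p i * q i = 1) :
    (Matrix.of fun i => (Pi.single (Fin.castLE ha i) (p i) : Fin a' → E)) *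
      (Matrix.of fun i => (Pi.single (Fin.castLE ha i) (q i) : Fin a' → E))ᵀ = 1 := by
  ext i j
  rw [mul_apply', Matrix.one_apply]
  change Pi.single (Fin.castLE ha i) (p i) ⬝ᵥ Pi.single (Fin.castLE ha j) (q j) = _
  rw [single_dotProduct, Pi.single_apply]
  simp only [(Fin.castLE_injective ha).eq_iff]
  split_ifs with h
  · rw [h, hpq]
  · rw [mul_zero]

theorem isUnit_diagonal_extend (ha : a ≤ a') {p : Fin a → E} (hp : ∀ i, p i ≠ 0) :
    IsUnit (diagonal (Function.extend (Fin.castLE ha) p 1)) := by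
  have h : ∀ i, Function.extend (Fin.castLE ha) p 1 i ≠ 0 := by
    intro i
    by_cases hi : ∃ j, Fin.castLE ha j = i
    · obtain ⟨j, rfl⟩ := hi
      rw [(Fin.castLE_injective ha).extend_apply]
      exact hp j
    · rw [Function.extend_apply' _ _ _ hi]
      exact one_ne_zero
  refine IsUnit.of_mul_eq_one (diagonal fun i => (Function.extend (Fin.castLE ha) p 1 i)⁻¹) ?_
  rw [diagonal_mul_diagonal, ← diagonal_one]
  exact congrArg _ (funext fun i => mul_inv_cancel₀ (h i))

theorem diagonal_mul_embedM_mul_diagonal (ha : a ≤ a') (hb : b ≤ b') (q : Fin a → E)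
    (p : Fin b → E) (M : Matrix (Fin a) (Fin b) E) :
    (Matrix.of fun i => (Pi.single (Fin.castLE ha i) (q i) : Fin a' → E))ᵀ * M *
      (Matrix.of fun j => (Pi.single (Fin.castLE hb j) (p j) : Fin b' → E)) =
    diagonal (Function.extend (Fin.castLE ha) q 1) * (embedM M : Matrix (Fin a') (Fin b') E) *
      diagonal (Function.extend (Fin.castLE hb) p 1) := by
  ext i j
  rw [mul_diagonal, diagonal_mul]
  simp only [mul_apply, transpose_apply, of_apply, embedM]
  split_ifs with h
  · obtain ⟨i, rfl⟩ : ∃ k, Fin.castLE ha k = i := ⟨⟨i, h.1⟩, rfl⟩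
    obtain ⟨j, rfl⟩ : ∃ k, Fin.castLE hb k = j := ⟨⟨j, h.2⟩, rfl⟩
    rw [(Fin.castLE_injective ha).extend_apply, (Fin.castLE_injective hb).extend_apply]
    simp [Pi.single_apply]
  · rw [mul_zero, zero_mul]
    refine Finset.sum_eq_zero fun k _ => ?_
    by_cases hi : i.val < a
    · rw [Pi.single_eq_of_ne, mul_zero]
      rintro rfl
      exact h ⟨hi, k.2⟩
    · rw [Finset.sum_eq_zero, zero_mul]
      intro l _
      rw [Pi.single_eq_of_ne, zero_mul]
      rintro rfl
      exact hi l.2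

end Blocks

/-- Proposition 5.4. -/
theorem main_proposition_anti_hom_case
    {D D' : Type} [DivisionRing D] [DivisionRing D']
    (hD : (4 : Cardinal) ≤ Cardinal.mk D)
    {m n m' n' : ℕ} (hm2 : 2 ≤ m) (hn2 : 2 ≤ n) (hm'2 : 2 ≤ m') (hn'2 : 2 ≤ n')
    (hm : n ≤ m') (hn : m ≤ n')
    (θ : Matrix (Fin m) (Fin n) D → Matrix (Fin m') (Fin n') D')
    (hhom : ∀ X Y, mrank (X - Y) = 1 → mrank (θ X - θ Y) = 1)
    (hnd : ¬ Degenerate θ) (h0 : θ 0 = 0)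
    (hrow : ∀ i : Fin m, θ '' rowSet D m n i ⊆ colSet D' m' n' (Fin.castLE hn i))
    (hcol : ∀ j : Fin n, θ '' colSet D m n j ⊆ rowSet D' m' n' (Fin.castLE hm j)) :
    ∃ P : Matrix (Fin m') (Fin m') D', ∃ Q : Matrix (Fin n') (Fin n') D',
      IsUnit P ∧ IsUnit Q ∧ P.IsDiag ∧ Q.IsDiag ∧
      ∃ σ : D → D',
        (∀ a b, σ (a + b) = σ a + σ b) ∧ (∀ a b, σ (a * b) = σ b * σ a) ∧ σ 1 = 1 ∧
        ∃ L : Matrix (Fin m) (Fin n) D',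
          (∀ X : Matrix (Fin m) (Fin n) D, IsUnit (1 + L * (X.map σ)ᵀ)) ∧
          (∀ X : Matrix (Fin m) (Fin n) D,
            θ X = P * (embedM ((X.map σ)ᵀ * Ring.inverse (1 + L * (X.map σ)ᵀ)) :
              Matrix (Fin m') (Fin n') D') * Q) ∧
          (Function.Surjective σ → L = 0 ∧ Function.Bijective σ) := by
  have h := isTransposing_of_not_degenerate (by omega) (by omega) (by omega) hn hhom hnd h0 hrow
  have hk : ∀ i v, θ (vecMulVec (Pi.single i 1) v) =
      vecMulVec (fun a => θ (vecMulVec (Pi.single i 1) v) a (Fin.castLE hn i))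
        (Pi.single (Fin.castLE hn i) 1) := by
    intro i v
    have h1 := hrow i ⟨vecMulVec (Pi.single i 1) v, fun a j ha => by
      rw [vecMulVec_apply, Pi.single_eq_of_ne ha, zero_mul], rfl⟩
    ext a b
    rw [vecMulVec_apply]
    by_cases hb : b = Fin.castLE hn i
    · rw [hb, Pi.single_eq_same, mul_one]
    · rw [Pi.single_eq_of_ne hb, mul_zero]
      exact h1 a b hb
  have hl : ∀ j u, θ (vecMulVec u (Pi.single j 1)) =
      vecMulVec (Pi.single (Fin.castLE hm j) 1)
        (θ (vecMulVec u (Pi.single j 1)) (Fin.castLE hm j)) := by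
    intro j u
    have h1 := hcol j ⟨vecMulVec u (Pi.single j 1), fun a b hb => by
      rw [vecMulVec_apply, Pi.single_eq_of_ne hb, mul_zero], rfl⟩
    ext a b
    rw [vecMulVec_apply]
    by_cases ha : a = Fin.castLE hm j
    · rw [ha, Pi.single_eq_same, one_mul]
    · rw [Pi.single_eq_of_ne ha, zero_mul]
      exact h1 a b ha
  obtain ⟨σ, p, q, L, φ, hσ1, hσ, hp, hq, -, hφ, hL⟩ := h.exists_normal_form hk hl hD hm2 hn2
    (linearIndependent_single_castLE hn fun _ => one_ne_zero)
    (linearIndependent_op_single_castLE hm fun _ => one_ne_zero)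
  have hfrac := fun X => eq_mul_inverse_of_fraction
    (of_single_castLE_mul_transpose hm fun j => inv_mul_cancel₀ (hq j))
    (of_single_castLE_mul_transpose hn fun i => mul_inv_cancel₀ (hp i))
    (h.fraction_of_normal_form hD
      (l := fun j u => (q j)⁻¹ • θ (vecMulVec u (Pi.single j 1)) (Fin.castLE hm j))
      (fun j u => by
        have hs : (Pi.single (Fin.castLE hm j) (q j) : Fin m' → D') =
            MulOpposite.op (q j) • Pi.single (Fin.castLE hm j) 1 := by
          rw [← Pi.single_smul, op_smul_eq_mul, one_mul]
        rw [hs, vecMulVec_op_smul, smul_smul, mul_inv_cancel₀ (hq j), one_smul, ← hl])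
      (linearIndependent_single_castLE hn hp) (linearIndependent_op_single_castLE hm hq) hσ1 hσ
      (L := Matrix.of L) (fun i j t => by
        rw [hφ, smul_smul, smul_smul, mul_assoc, Matrix.of_apply, hL, ← smul_smul,
          ← Pi.single_smul, smul_eq_mul, mul_one])
      (by omega) (of_single_castLE_mul_transpose hm fun j => inv_mul_cancel₀ (hq j))
      (of_single_castLE_mul_transpose hn fun i => mul_inv_cancel₀ (hp i)) X)
  refine ⟨_, _, isUnit_diagonal_extend hm hq, isUnit_diagonal_extend hn hp, isDiag_diagonal _,
    isDiag_diagonal _, σ, map_add σ, hσ, hσ1, Matrix.of L, fun X => (hfrac X).1, fun X => ?_,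
    fun hs => ⟨eq_zero_of_forall_isUnit_one_add_mul hs fun X => (hfrac X).1, ?_, hs⟩⟩
  · rw [(hfrac X).2, diagonal_mul_embedM_mul_diagonal]
  · obtain ⟨⟨τ, hτ⟩, -⟩ := exists_ringHom_of_antihom hσ1 hσ
    intro a b hab
    exact τ.injective (by rw [hτ, hτ, hab])
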